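/- arXiv:math/0008088 — 8 statements merged into one kernel-verified Lean document; each statement's English description precedes it below -/
import Mathlib

section
/- Let n ≥ 1, let Ω be a measurable subset of the unit sphere S^n ⊂ ℝ^{n+1}, let μ be a finite positive measure on Ω, and let G : [0,π] → ℝ be continuous, positive on (0,π), and symmetric about π/2 (G(π−θ) = G(θ) for all θ). Then there exists a unit vector e ∈ S^n such that for every vector v ∈ ℝ^{n+1} orthogonal to e, ∫_Ω ⟨x, v⟩ · G(arccos⟨x, e⟩) dμ(x) = 0. Equivalently, the vector ∫_Ω x · G(arccos⟨x, e⟩) dμ(x) is a scalar multiple of e. -/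
open Real MeasureTheory Set
open scoped InnerProductSpace

section SphereCriticalPoint

variable {E : Type*} [NormedAddCommGroup E] [InnerProductSpace ℝ E]
  [MeasurableSpace E] [BorelSpace E]

/-- The integral of `Φ ⟪x, e⟫` against a finite measure carried by the unit sphere depends
continuously on `e` in the unit sphere. -/
lemma continuousOn_integral_comp_inner_sphere (ν : Measure E) [IsFiniteMeasure ν]
    (hν : ∀ᵐ x ∂ν, ‖x‖ = 1) {Φ : ℝ → ℝ} (hΦ : Continuous Φ) :
    ContinuousOn (fun e : E ↦ ∫ x, Φ ⟪x, e⟫_ℝ ∂ν) (Metric.sphere 0 1) := by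
  obtain ⟨B, hB⟩ := (isCompact_Icc (a := (-1 : ℝ)) (b := 1)).exists_bound_of_continuousOn
    hΦ.continuousOn
  refine continuousOn_of_dominated (bound := fun _ ↦ B)
    (fun e _ ↦ Continuous.aestronglyMeasurable (by fun_prop)) (fun e he ↦ ?_)
    (integrable_const B) (ae_of_all _ fun x ↦ Continuous.continuousOn (by fun_prop))
  filter_upwards [hν] with x hx
  refine hB _ (abs_le.mp ?_)
  simpa [hx, mem_sphere_zero_iff_norm.mp he] using abs_real_inner_le_norm x e

/-- Differentiation of `∫ Φ ⟪x, ·⟫` along a great circle, where `Φ` is `C¹` with bounded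
derivative `H`. -/
lemma hasDerivAt_integral_comp_inner_great_circle (ν : Measure E) [IsFiniteMeasure ν]
    (hν : ∀ᵐ x ∂ν, ‖x‖ = 1) {Φ H : ℝ → ℝ} {M : ℝ} (hΦ : ∀ t, HasDerivAt Φ (H t) t)
    (hH : Continuous H) (hM : ∀ t, |H t| ≤ M) {e w : E} (he : ‖e‖ = 1) (hw : ‖w‖ = 1) :
    HasDerivAt (fun t : ℝ ↦ ∫ x, Φ ⟪x, cos t • e + sin t • w⟫_ℝ ∂ν)
      (∫ x, ⟪x, w⟫_ℝ * H ⟪x, e⟫_ℝ ∂ν) 0 := by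
  have hΦc : Continuous Φ := continuous_iff_continuousAt.2 fun t ↦ (hΦ t).continuousAt
  have hM0 : 0 ≤ M := (abs_nonneg _).trans (hM 0)
  obtain ⟨B, hB⟩ := (isCompact_Icc (a := (-1 : ℝ)) (b := 1)).exists_bound_of_continuousOn
    hΦc.continuousOn
  have key := hasDerivAt_integral_of_dominated_loc_of_deriv_le (μ := ν) (x₀ := (0 : ℝ))
    (s := univ) (bound := fun _ ↦ M * 2)
    (F := fun t x ↦ Φ ⟪x, cos t • e + sin t • w⟫_ℝ)
    (F' := fun t x ↦ H ⟪x, cos t • e + sin t • w⟫_ℝ * (-sin t * ⟪x, e⟫_ℝ + cos t * ⟪x, w⟫_ℝ))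
    Filter.univ_mem
    (Filter.Eventually.of_forall fun t ↦ Continuous.aestronglyMeasurable (by fun_prop))
    ?_ (Continuous.aestronglyMeasurable (by fun_prop)) ?_ (integrable_const _) ?_
  · simpa [mul_comm] using key.2
  · refine Integrable.of_bound (C := B) (Continuous.aestronglyMeasurable (by fun_prop)) ?_
    filter_upwards [hν] with x hx
    refine hB _ (abs_le.mp ?_)
    simpa [hx, he] using abs_real_inner_le_norm x e
  · filter_upwards [hν] with x hx t _
    have h1 : |⟪x, e⟫_ℝ| ≤ 1 := by simpa [hx, he] using abs_real_inner_le_norm x e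
    have h2 : |⟪x, w⟫_ℝ| ≤ 1 := by simpa [hx, hw] using abs_real_inner_le_norm x w
    rw [Real.norm_eq_abs, abs_mul]
    refine mul_le_mul (hM _) ((abs_add_le _ _).trans ?_) (abs_nonneg _) hM0
    rw [abs_mul, abs_mul, abs_neg]
    nlinarith [mul_le_one₀ (abs_sin_le_one t) (abs_nonneg _) h1,
      mul_le_one₀ (abs_cos_le_one t) (abs_nonneg _) h2]
  · refine ae_of_all _ fun x t _ ↦ ?_
    have h : HasDerivAt (fun t : ℝ ↦ ⟪x, cos t • e + sin t • w⟫_ℝ)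
        (-sin t * ⟪x, e⟫_ℝ + cos t * ⟪x, w⟫_ℝ) t := by
      simp only [inner_add_right, real_inner_smul_right]
      exact ((hasDerivAt_cos t).mul_const _).add ((hasDerivAt_sin t).mul_const _)
    exact (hΦ _).comp t h

/-- For a finite measure carried by the unit sphere and a bounded continuous `H`, some unit
vector `e` is parallel to the center of mass weighted by `H ⟪x, e⟫`: a maximizer over the sphere
of `∫ Φ ⟪x, e⟫`, where `Φ` is a primitive of `H`. -/
lemma exists_unit_forall_orthogonal_integral_eq_zero [FiniteDimensional ℝ E] [Nontrivial E]
    (ν : Measure E) [IsFiniteMeasure ν] (hν : ∀ᵐ x ∂ν, ‖x‖ = 1) {H : ℝ → ℝ} {M : ℝ} (hH : Continuous H)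
    (hM : ∀ t, |H t| ≤ M) :
    ∃ e : E, ‖e‖ = 1 ∧ ∀ v : E, ⟪e, v⟫_ℝ = 0 → ∫ x, ⟪x, v⟫_ℝ * H ⟪x, e⟫_ℝ ∂ν = 0 := by
  set Φ : ℝ → ℝ := fun t ↦ ∫ s in (0 : ℝ)..t, H s
  have hΦ (t : ℝ) : HasDerivAt Φ (H t) t := hH.integral_hasStrictDerivAt 0 t |>.hasDerivAt
  have hΦc : Continuous Φ := continuous_iff_continuousAt.2 fun t ↦ (hΦ t).continuousAt
  obtain ⟨e, he, hmax⟩ := (isCompact_sphere (0 : E) 1).exists_isMaxOn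
    (NormedSpace.sphere_nonempty.2 zero_le_one)
    (continuousOn_integral_comp_inner_sphere ν hν hΦc)
  rw [mem_sphere_zero_iff_norm] at he
  refine ⟨e, he, fun v hv ↦ ?_⟩
  rcases eq_or_ne v 0 with rfl | hv0
  · simp
  set w : E := ‖v‖⁻¹ • v with hw_def
  have hw : ‖w‖ = 1 := norm_smul_inv_norm (𝕜 := ℝ) hv0
  have hew : ⟪e, w⟫_ℝ = 0 := by rw [hw_def, real_inner_smul_right, hv, mul_zero]
  have hvw : v = ‖v‖ • w := by rw [hw_def, smul_inv_smul₀ (norm_ne_zero_iff.2 hv0)]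
  have hcirc (t : ℝ) : cos t • e + sin t • w ∈ Metric.sphere (0 : E) 1 := by
    rw [mem_sphere_zero_iff_norm, ← sq_eq_sq₀ (norm_nonneg _) zero_le_one, norm_add_sq_real,
      norm_smul, norm_smul, real_inner_smul_left, real_inner_smul_right, hew, he, hw]
    simp
  have hzero : ∫ x, ⟪x, w⟫_ℝ * H ⟪x, e⟫_ℝ ∂ν = 0 := by
    refine IsLocalMax.hasDerivAt_eq_zero (Filter.Eventually.of_forall fun t ↦ ?_)
      (hasDerivAt_integral_comp_inner_great_circle ν hν hΦ hH hM he hw)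
    simpa using hmax (hcirc t)
  rw [hvw]
  simp only [real_inner_smul_right, mul_assoc, integral_const_mul, hzero, mul_zero]

end SphereCriticalPoint

/-- Center of Mass Theorem for domains in `S^n`: for a finite measure on a subset of the
unit sphere and a weight `G` continuous on `[0,π]`, positive on `(0,π)`, and symmetric
about `π/2`, there is a unit vector `e` (a "north pole") such that the weighted center of
mass is parallel to `e`, i.e., orthogonal to every `v ⊥ e`. -/
theorem center_of_mass_sphere (n : ℕ) (hn : 1 ≤ n)
    (Ω : Set (EuclideanSpace ℝ (Fin (n + 1)))) (hΩmeas : MeasurableSet Ω)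
    (hΩsub : Ω ⊆ Metric.sphere (0 : EuclideanSpace ℝ (Fin (n + 1))) 1)
    (μ : Measure (EuclideanSpace ℝ (Fin (n + 1)))) [IsFiniteMeasure μ]
    (G : ℝ → ℝ) (hGcont : ContinuousOn G (Icc 0 π))
    (hGpos : ∀ θ ∈ Ioo 0 π, 0 < G θ)
    (hGsym : ∀ θ ∈ Icc 0 π, G (π - θ) = G θ) :
    ∃ e : EuclideanSpace ℝ (Fin (n + 1)), ‖e‖ = 1 ∧
      ∀ v : EuclideanSpace ℝ (Fin (n + 1)), ⟪e, v⟫_ℝ = 0 →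
        ∫ x in Ω, ⟪x, v⟫_ℝ * G (Real.arccos ⟪x, e⟫_ℝ) ∂μ = 0 := by
  obtain ⟨M, hM⟩ := isCompact_Icc.exists_bound_of_continuousOn hGcont
  refine exists_unit_forall_orthogonal_integral_eq_zero (μ.restrict Ω) ?_
    (H := fun t ↦ G (Real.arccos t)) (M := M) ?_ fun t ↦ hM _ ⟨arccos_nonneg t, arccos_le_pi t⟩
  · filter_upwards [ae_restrict_mem hΩmeas] with x hx
    exact mem_sphere_zero_iff_norm.mp (hΩsub hx)
  · exact hGcont.comp_continuous continuous_arccos fun t ↦ ⟨arccos_nonneg t, arccos_le_pi t⟩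
end

section
/- Let n ≥ 2 be EVEN, let Ω be a measurable subset of the unit sphere S^n ⊂ ℝ^{n+1}, let μ be a finite positive measure on Ω, and let G : [0,π] → ℝ be continuous and positive on (0,π) (no symmetry about π/2 assumed). Then there exists a unit vector e ∈ S^n such that for every vector v ∈ ℝ^{n+1} orthogonal to e, ∫_Ω ⟨x, v⟩ · G(arccos⟨x, e⟩) dμ(x) = 0. -/
open Real MeasureTheory Set
open scoped InnerProductSpace

section

variable {E : Type*} [NormedAddCommGroup E] [InnerProductSpace ℝ E] [MeasurableSpace E]
  [BorelSpace E] {ν : Measure E} [IsFiniteMeasure ν]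
  {H g : ℝ → ℝ} {M : ℝ}

/-- Along a differentiable curve, the potential `e ↦ ∫ H ⟪x, e⟫` of a measure supported in the
unit ball may be differentiated under the integral sign, if `H` has a bounded derivative. -/
theorem hasDerivAt_integral_comp_inner (hν : ∀ᵐ x ∂ν, ‖x‖ ≤ 1)
    (hH : ∀ t, HasDerivAt H (g t) t) (hM : ∀ t, ‖g t‖ ≤ M)
    {c c' : ℝ → E} (hc : ∀ t, HasDerivAt c (c' t) t) {L : ℝ} (hL : ∀ t, ‖c' t‖ ≤ L)
    {t₀ : ℝ} (hint : Integrable (fun x ↦ H ⟪x, c t₀⟫_ℝ) ν)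
    (hg : Continuous g) :
    HasDerivAt (fun t ↦ ∫ x, H ⟪x, c t⟫_ℝ ∂ν)
      (∫ x, g ⟪x, c t₀⟫_ℝ * ⟪x, c' t₀⟫_ℝ ∂ν) t₀ := by
  have hHc : Continuous H := continuous_iff_continuousAt.2 fun t ↦ (hH t).continuousAt
  have hM0 : 0 ≤ M := (norm_nonneg _).trans (hM 0)
  refine (hasDerivAt_integral_of_dominated_loc_of_deriv_le (bound := fun _ ↦ M * L)
    (F' := fun t x ↦ g ⟪x, c t⟫_ℝ * ⟪x, c' t⟫_ℝ) Filter.univ_mem ?_ hint ?_ ?_ ?_ ?_).2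
  · exact .of_forall fun t ↦ Continuous.aestronglyMeasurable (by fun_prop)
  · exact Continuous.aestronglyMeasurable (by fun_prop)
  · filter_upwards [hν] with x hx t _
    rw [norm_mul]
    refine mul_le_mul (hM _) ?_ (norm_nonneg _) hM0
    calc ‖⟪x, c' t⟫_ℝ‖ ≤ ‖x‖ * ‖c' t‖ := norm_inner_le_norm _ _
      _ ≤ 1 * L := mul_le_mul hx (hL t) (norm_nonneg _) zero_le_one
      _ = L := one_mul L
  · exact integrable_const _
  · refine .of_forall fun x t _ ↦ ?_
    have h := (hasDerivAt_const t x).inner ℝ (hc t)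
    rw [inner_zero_left, add_zero] at h
    exact (hH _).comp t h

/-- For a finite measure supported in the unit ball and a bounded continuous weight `g`, the
tangential part of the vector field `e ↦ ∫ g ⟪x, e⟫ x` vanishes somewhere on the unit sphere,
since this vector field is a gradient. -/
theorem exists_unit_integral_inner_mul_eq_zero [FiniteDimensional ℝ E] [Nontrivial E]
    (hν : ∀ᵐ x ∂ν, ‖x‖ ≤ 1) (hg : Continuous g) (hM : ∀ t, ‖g t‖ ≤ M) :
    ∃ e : E, ‖e‖ = 1 ∧ ∀ v : E, ⟪e, v⟫_ℝ = 0 → ∫ x, ⟪x, v⟫_ℝ * g ⟪x, e⟫_ℝ ∂ν = 0 := by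
  set H : ℝ → ℝ := fun t ↦ ∫ s in (0 : ℝ)..t, g s
  have hH (t : ℝ) : HasDerivAt H (g t) t := hg.integral_hasStrictDerivAt 0 t |>.hasDerivAt
  have hHc : Continuous H := continuous_iff_continuousAt.2 fun t ↦ (hH t).continuousAt
  have hM0 : 0 ≤ M := (norm_nonneg _).trans (hM 0)
  have hbound (e : E) (he : ‖e‖ = 1) : ∀ᵐ x ∂ν, ‖H ⟪x, e⟫_ℝ‖ ≤ M := by
    filter_upwards [hν] with x hx
    calc ‖H ⟪x, e⟫_ℝ‖ ≤ M * |⟪x, e⟫_ℝ - 0| :=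
          intervalIntegral.norm_integral_le_of_norm_le_const fun s _ ↦ hM s
      _ ≤ M * 1 := by
        refine mul_le_mul_of_nonneg_left ?_ hM0
        rw [sub_zero]
        exact (abs_real_inner_le_norm x e).trans (by rwa [he, mul_one])
      _ = M := mul_one M
  have hint (e : E) (he : ‖e‖ = 1) : Integrable (fun x ↦ H ⟪x, e⟫_ℝ) ν :=
    .of_bound (Continuous.aestronglyMeasurable (by fun_prop)) M (hbound e he)
  have hcont : ContinuousOn (fun e ↦ ∫ x, H ⟪x, e⟫_ℝ ∂ν) (Metric.sphere (0 : E) 1) := by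
    refine continuousOn_of_dominated (bound := fun _ ↦ M) ?_ ?_ (integrable_const _) ?_
    · exact fun e _ ↦ Continuous.aestronglyMeasurable (by fun_prop)
    · exact fun e he ↦ hbound e (mem_sphere_zero_iff_norm.1 he)
    · exact .of_forall fun x ↦ Continuous.continuousOn (by fun_prop)
  obtain ⟨e, he, hmax⟩ := (isCompact_sphere (0 : E) 1).exists_isMaxOn
    (NormedSpace.sphere_nonempty.2 zero_le_one) hcont
  have he1 : ‖e‖ = 1 := mem_sphere_zero_iff_norm.1 he
  have hunit (w : E) (hw : ‖w‖ = 1) (hew : ⟪e, w⟫_ℝ = 0) :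
      ∫ x, ⟪x, w⟫_ℝ * g ⟪x, e⟫_ℝ ∂ν = 0 := by
    let c : ℝ → E := fun t ↦ cos t • e + sin t • w
    have hc (t : ℝ) : HasDerivAt c (-sin t • e + cos t • w) t :=
      ((hasDerivAt_cos t).smul_const e).add ((hasDerivAt_sin t).smul_const w)
    have hc' (t : ℝ) : ‖-sin t • e + cos t • w‖ ≤ 1 + 1 := by
      refine norm_add_le_of_le ?_ ?_
      · rw [norm_smul, he1, mul_one, norm_neg]
        exact abs_sin_le_one t
      · rw [norm_smul, hw, mul_one]
        exact abs_cos_le_one t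
    have hc1 (t : ℝ) : c t ∈ Metric.sphere (0 : E) 1 := by
      have h : ‖c t‖ * ‖c t‖ = 1 := by
        rw [norm_add_sq_eq_norm_sq_add_norm_sq_real
          (by rw [real_inner_smul_left, real_inner_smul_right, hew]; ring),
          norm_smul, norm_smul, he1, hw, mul_one, mul_one, norm_eq_abs, norm_eq_abs,
          abs_mul_abs_self, abs_mul_abs_self]
        linarith [sin_sq_add_cos_sq t]
      rw [mem_sphere_zero_iff_norm]
      nlinarith [norm_nonneg (c t)]
    have hc0 : c 0 = e := by simp [c]
    have hderiv := hasDerivAt_integral_comp_inner hν hH hM hc hc' (t₀ := 0)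
      (by rw [hc0]; exact hint e he1) hg
    have hlocal : IsLocalMax (fun t ↦ ∫ x, H ⟪x, c t⟫_ℝ ∂ν) 0 :=
      .of_forall fun t ↦ by
        simp only [hc0]
        exact hmax (hc1 t)
    have hzero := hlocal.hasDerivAt_eq_zero hderiv
    simpa [hc0, mul_comm] using hzero
  refine ⟨e, he1, fun v hv ↦ ?_⟩
  rcases eq_or_ne v 0 with rfl | hv0
  · simp
  · have h := hunit (‖v‖⁻¹ • v) (norm_smul_inv_norm hv0)
      (by rw [real_inner_smul_right, hv, mul_zero])
    simp only [real_inner_smul_right, mul_assoc, integral_const_mul] at h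
    exact (mul_eq_zero.1 h).resolve_left (inv_ne_zero (norm_ne_zero_iff.2 hv0))

end

/-- Center of Mass Theorem for domains in `S^n` with `n` even: for a finite measure on a
subset of the unit sphere and a weight `G` continuous on `[0,π]` and positive on `(0,π)`
(no symmetry about `π/2` assumed), there is a unit vector `e` such that the weighted
center of mass is parallel to `e`. -/
theorem center_of_mass_sphere_even (n : ℕ) (hn : 2 ≤ n) (hneven : Even n)
    (Ω : Set (EuclideanSpace ℝ (Fin (n + 1)))) (hΩmeas : MeasurableSet Ω)
    (hΩsub : Ω ⊆ Metric.sphere (0 : EuclideanSpace ℝ (Fin (n + 1))) 1)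
    (μ : Measure (EuclideanSpace ℝ (Fin (n + 1)))) [IsFiniteMeasure μ]
    (G : ℝ → ℝ) (hGcont : ContinuousOn G (Icc 0 π))
    (hGpos : ∀ θ ∈ Ioo 0 π, 0 < G θ) :
    ∃ e : EuclideanSpace ℝ (Fin (n + 1)), ‖e‖ = 1 ∧
      ∀ v : EuclideanSpace ℝ (Fin (n + 1)), ⟪e, v⟫_ℝ = 0 →
        ∫ x in Ω, ⟪x, v⟫_ℝ * G (Real.arccos ⟪x, e⟫_ℝ) ∂μ = 0 := by
  have harccos (t : ℝ) : arccos t ∈ Icc 0 π := ⟨arccos_nonneg t, arccos_le_pi t⟩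
  obtain ⟨M, hM⟩ := isCompact_Icc.exists_bound_of_continuousOn hGcont
  refine exists_unit_integral_inner_mul_eq_zero (ν := μ.restrict Ω) (g := fun t ↦ G (arccos t))
    ?_ (hGcont.comp_continuous continuous_arccos harccos) fun t ↦ hM _ (harccos t)
  exact (ae_restrict_mem hΩmeas).mono fun x hx ↦ (mem_sphere_zero_iff_norm.1 (hΩsub hx)).le
end

section
/- Lowering relation: let n ≥ 2 be an integer, m ≥ 1 an integer, λ ∈ ℝ, and 0 < θ1 ≤ π. If y is three times differentiable on (0,θ1) and satisfies −y''(θ) − (n−1) cot θ · y'(θ) + m(m+n−2)(sin θ)^{-2} y(θ) = λ y(θ) on (0,θ1), then the function w(θ) := y'(θ) + (m+n−2) cot θ · y(θ) satisfies −w''(θ) − (n−1) cot θ · w'(θ) + (m−1)(m+n−3)(sin θ)^{-2} w(θ) = λ w(θ) on (0,θ1). -/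
open Real Set

theorem hasDerivAt_cot_of_sin_ne_zero {x : ℝ} (hx : Real.sin x ≠ 0) :
    HasDerivAt Real.cot (-(1 / Real.sin x ^ 2)) x := by
  have hcot : Real.cot = fun t => Real.cos t / Real.sin t :=
    funext fun t => Real.cot_eq_cos_div_sin t
  rw [hcot]
  refine ((Real.hasDerivAt_cos x).div (Real.hasDerivAt_sin x) hx).congr_deriv ?_
  field_simp
  linear_combination -(Real.sin_sq_add_cos_sq x)

theorem hasDerivAt_one_div_sin_sq {x : ℝ} (hx : Real.sin x ≠ 0) :
    HasDerivAt (fun t => 1 / Real.sin t ^ 2) (-2 * Real.cot x * (1 / Real.sin x ^ 2)) x := by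
  refine ((hasDerivAt_const x (1 : ℝ)).div ((Real.hasDerivAt_sin x).pow 2)
    (pow_ne_zero 2 hx)).congr_deriv ?_
  rw [Real.cot_eq_cos_div_sin]
  simp only [Pi.pow_apply]
  field_simp
  norm_num
  ring

/-- Lowering relation: if `y` solves the `m`-th radial equation
`-y'' - (n-1) cot θ · y' + m(m+n-2) y / sin²θ = λ y` on `(0,θ1)` with `m ≥ 1`,
then `w = y' + (m+n-2) cot θ · y` solves the `(m-1)`-st radial equation. -/
theorem lowering_relation (n m : ℕ) (hn : 2 ≤ n) (hm : 1 ≤ m) (lam θ1 : ℝ)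
    (hθ1 : 0 < θ1) (hθ1' : θ1 ≤ π) (y w : ℝ → ℝ)
    (hy : ∀ θ ∈ Ioo 0 θ1, DifferentiableAt ℝ y θ ∧ DifferentiableAt ℝ (deriv y) θ ∧
      DifferentiableAt ℝ (deriv (deriv y)) θ)
    (hode : ∀ θ ∈ Ioo 0 θ1,
      -(deriv (deriv y) θ) - ((n : ℝ) - 1) * Real.cot θ * deriv y θ
        + (m : ℝ) * ((m : ℝ) + (n : ℝ) - 2) * y θ / Real.sin θ ^ 2 = lam * y θ)
    (hw : ∀ θ, w θ = deriv y θ + ((m : ℝ) + (n : ℝ) - 2) * Real.cot θ * y θ) :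
    ∀ θ ∈ Ioo 0 θ1,
      -(deriv (deriv w) θ) - ((n : ℝ) - 1) * Real.cot θ * deriv w θ
        + ((m : ℝ) - 1) * ((m : ℝ) + (n : ℝ) - 3) * w θ / Real.sin θ ^ 2 = lam * w θ := by
  set k : ℝ := (m : ℝ) + (n : ℝ) - 2 with hk
  have hsin : ∀ θ ∈ Ioo 0 θ1, Real.sin θ ≠ 0 := fun θ hθ =>
    (Real.sin_pos_of_pos_of_lt_pi hθ.1 (hθ.2.trans_le hθ1')).ne'
  have hw_eq : w = fun t => deriv y t + k * Real.cot t * y t := funext hw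
  have hw' : ∀ θ ∈ Ioo 0 θ1, deriv w θ = deriv (deriv y) θ
      + (k * -(1 / Real.sin θ ^ 2) * y θ + k * Real.cot θ * deriv y θ) := by
    intro θ hθ
    obtain ⟨h0, h1, -⟩ := hy θ hθ
    rw [hw_eq]
    exact (h1.hasDerivAt.add
      (((hasDerivAt_cot_of_sin_ne_zero (hsin θ hθ)).const_mul k).mul h0.hasDerivAt)).deriv
  intro θ hθ
  have hnhds : Ioo 0 θ1 ∈ nhds θ := isOpen_Ioo.mem_nhds hθ
  obtain ⟨h0, h1, h2⟩ := hy θ hθ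
  have hC := hasDerivAt_cot_of_sin_ne_zero (hsin θ hθ)
  have hS := hasDerivAt_one_div_sin_sq (hsin θ hθ)
  have hw'' := ((h2.hasDerivAt.add (((hS.neg.const_mul k).mul h0.hasDerivAt).add
    ((hC.const_mul k).mul h1.hasDerivAt))).congr_of_eventuallyEq
      (Filter.eventuallyEq_of_mem hnhds hw')).deriv
  have hode_deriv := ((((h2.hasDerivAt.neg.sub ((hC.const_mul ((n : ℝ) - 1)).mul
    h1.hasDerivAt)).add ((hS.const_mul ((m : ℝ) * k)).mul h0.hasDerivAt)).sub
      (h0.hasDerivAt.const_mul lam)).congr_of_eventuallyEq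
        (f₁ := fun _ => (0 : ℝ)) (Filter.eventuallyEq_of_mem hnhds fun t ht => by
          have := hode t ht
          simp only [Pi.add_apply, Pi.sub_apply, Pi.mul_apply, Pi.neg_apply]
          linear_combination -this)).unique (hasDerivAt_const θ (0 : ℝ))
  have hode_at := hode θ hθ
  rw [hw'', hw' θ hθ, hw θ]
  simp only [Pi.neg_apply] at hode_deriv ⊢
  simp only [div_eq_mul_inv, one_mul] at hode_deriv hode_at ⊢
  generalize (Real.sin θ ^ 2)⁻¹ = S at *
  have hk' : (n : ℝ) = k + 2 - m := by rw [hk]; ring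
  rw [hk'] at hode_deriv hode_at ⊢
  linear_combination hode_deriv + k * Real.cot θ * hode_at
end

section
/- Let n ≥ 2 and 0 < θ1 < π. Let τ > 0 and let v be twice continuously differentiable on (0,θ1), bounded near 0, satisfying v'' + (n−1) cot θ · v' + τ v = 0 on (0,θ1), with v(θ) → 0 as θ → θ1⁻, and suppose there is a ∈ (0,θ1) with v > 0 on (0,a), v(a) = 0, and v < 0 on (a,θ1) (so v is a second eigenfunction of the m = 0 radial problem with eigenvalue τ = λ2(h0)). Let λ > 0 and let h be twice continuously differentiable and bounded on (0,θ1) with h(θ) → 1 as θ → 0⁺, satisfying h'' + (n−1) cot θ · h' + λ h = 0 on (0,θ1), and suppose g := −h' is positive on (0,θ1) with g(θ) → 0 as θ → 0⁺ and as θ → θ1⁻ (so g is a first eigenfunction of the m = 1 radial problem with eigenvalue λ = λ1(h1)). Then τ > λ. Consequently the second Dirichlet eigenvalue of the geodesic ball of radius θ1 in S^n is the first eigenvalue of the m = 1 radial problem. -/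
open Real Set Filter

/-- The flux `-sin^(m+1) u'` of a solution of the radial equation with `m = 0` in dimension
`m + 2`. -/
theorem hasDerivAt_radial_flux {m : ℕ} {T μ : ℝ} (hT : T < π) {u : ℝ → ℝ}
    (hu : ContDiffOn ℝ 2 u (Ioo 0 T))
    (hode : ∀ θ ∈ Ioo 0 T,
      deriv (deriv u) θ + ((m : ℝ) + 1) * Real.cot θ * deriv u θ + μ * u θ = 0)
    {x : ℝ} (hx : x ∈ Ioo 0 T) :
    HasDerivAt (fun t => -(sin t ^ (m + 1) * deriv u t)) (μ * sin x ^ (m + 1) * u x) x := by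
  have hs : 0 < sin x := sin_pos_of_pos_of_lt_pi hx.1 (hx.2.trans hT)
  have hd : DifferentiableAt ℝ (deriv u) x :=
    ((hu.deriv_of_isOpen isOpen_Ioo (by norm_num : (1 : WithTop ℕ∞) + 1 ≤ 2)).differentiableOn
      one_ne_zero).differentiableAt (isOpen_Ioo.mem_nhds hx)
  have h := (((hasDerivAt_sin x).pow (m + 1)).mul hd.hasDerivAt).neg
  have hode' := hode x hx
  rw [Real.cot_eq_cos_div_sin] at hode'
  refine h.congr_deriv ?_
  have e : deriv (deriv u) x = -(((m : ℝ) + 1) * (cos x / sin x) * deriv u x + μ * u x) := by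
    linarith
  rw [e]
  push_cast
  simp only [Pi.pow_apply]
  field_simp
  ring

theorem hasDerivAt_of_contDiffOn_Ioo {T : ℝ} {u : ℝ → ℝ} (hu : ContDiffOn ℝ 2 u (Ioo 0 T))
    {x : ℝ} (hx : x ∈ Ioo 0 T) : HasDerivAt u (deriv u x) x :=
  ((hu.differentiableOn two_ne_zero).differentiableAt (isOpen_Ioo.mem_nhds hx)).hasDerivAt

/-- A function bounded above near `0` cannot have derivative at most `-c / t` there. -/
theorem false_of_deriv_le_neg_div {t₀ c M : ℝ} (ht₀ : 0 < t₀) (hc : 0 < c) {f : ℝ → ℝ}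
    (hf : ∀ t ∈ Ioc 0 t₀, DifferentiableAt ℝ f t)
    (hf' : ∀ t ∈ Ioc 0 t₀, deriv f t ≤ -(c / t))
    (hM : ∀ᶠ t in nhdsWithin 0 (Ioi 0), f t ≤ M) : False := by
  have hd : ∀ t ∈ Ioc 0 t₀, HasDerivAt (fun t => f t + c * log t) (deriv f t + c * t⁻¹) t :=
    fun t ht => (hf t ht).hasDerivAt.add ((hasDerivAt_log ht.1.ne').const_mul c)
  have hanti : AntitoneOn (fun t => f t + c * log t) (Ioc 0 t₀) := by
    refine antitoneOn_of_deriv_nonpos (convex_Ioc 0 t₀)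
      (fun t ht => (hd t ht).continuousAt.continuousWithinAt) ?_ ?_ <;> rw [interior_Ioc]
    · exact fun t ht => (hd t (Ioo_subset_Ioc_self ht)).differentiableAt.differentiableWithinAt
    · intro t ht
      have ht' := Ioo_subset_Ioc_self ht
      rw [(hd t ht').deriv]
      have := hf' t ht'
      rw [div_eq_mul_inv] at this
      linarith
  have hlog : ∀ᶠ t in nhdsWithin 0 (Ioi 0), log t < (f t₀ + c * log t₀ - M) / c :=
    tendsto_log_nhdsGT_zero.eventually_lt_atBot _
  obtain ⟨t, ⟨hMt, hlt⟩, ht⟩ :=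
    ((hM.and hlog).and (Ioc_mem_nhdsGT ht₀)).exists
  have h1 := hanti ht ⟨ht₀, le_rfl⟩ ht.2
  rw [lt_div_iff₀ hc] at hlt
  simp only at h1
  linarith

/-- Picone-type identity for two radial solutions, in terms of their fluxes. -/
theorem hasDerivAt_flux_wronskian {m : ℕ} {T τ lam : ℝ} (hT : T < π) {v h : ℝ → ℝ}
    (hv : ContDiffOn ℝ 2 v (Ioo 0 T)) (hh : ContDiffOn ℝ 2 h (Ioo 0 T))
    (hvode : ∀ θ ∈ Ioo 0 T,
      deriv (deriv v) θ + ((m : ℝ) + 1) * Real.cot θ * deriv v θ + τ * v θ = 0)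
    (hhode : ∀ θ ∈ Ioo 0 T,
      deriv (deriv h) θ + ((m : ℝ) + 1) * Real.cot θ * deriv h θ + lam * h θ = 0)
    {x : ℝ} (hx : x ∈ Ioo 0 T) :
    HasDerivAt (fun t => lam * (h t * -(sin t ^ (m + 1) * deriv v t))
        - τ * (v t * -(sin t ^ (m + 1) * deriv h t)))
      ((τ - lam) * (-deriv h x * -(sin x ^ (m + 1) * deriv v x))) x := by
  refine ((((hasDerivAt_of_contDiffOn_Ioo hh hx).mul
    (hasDerivAt_radial_flux hT hv hvode hx)).const_mul lam).sub
    (((hasDerivAt_of_contDiffOn_Ioo hv hx).mul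
    (hasDerivAt_radial_flux hT hh hhode hx)).const_mul τ)).congr_deriv ?_
  ring

/-- The flux of a solution that is positive and bounded near the pole is positive and vanishes
at the pole. -/
theorem radial_flux_pos_and_tendsto_zero {m : ℕ} {T μ a : ℝ} (hT : T < π) (hμ : 0 < μ)
    {v : ℝ → ℝ} (hv : ContDiffOn ℝ 2 v (Ioo 0 T))
    (hode : ∀ θ ∈ Ioo 0 T,
      deriv (deriv v) θ + ((m : ℝ) + 1) * Real.cot θ * deriv v θ + μ * v θ = 0)
    (hbdd : ∃ M, ∀ᶠ θ in nhdsWithin 0 (Ioi 0), |v θ| ≤ M)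
    (ha : a ∈ Ioo 0 T) (hpos : ∀ θ ∈ Ioo 0 a, 0 < v θ) :
    (∀ t ∈ Ioc 0 a, 0 < -(sin t ^ (m + 1) * deriv v t)) ∧
      Tendsto (fun t => -(sin t ^ (m + 1) * deriv v t)) (nhdsWithin 0 (Ioi 0)) (nhds 0) := by
  obtain ⟨M, hM⟩ := hbdd
  have hsub : ∀ t ∈ Ioc 0 a, t ∈ Ioo 0 T := fun t ht => ⟨ht.1, ht.2.trans_lt ha.2⟩
  have hsin : ∀ t ∈ Ioo 0 T, 0 < sin t := fun t ht =>
    sin_pos_of_pos_of_lt_pi ht.1 (ht.2.trans hT)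
  have hpow : ∀ t ∈ Ioo 0 T, sin t ^ (m + 1) ≤ t := fun t ht =>
    (pow_le_of_le_one (hsin t ht).le (sin_le_one t) m.succ_ne_zero).trans (sin_lt ht.1).le
  have hdiff : ∀ t ∈ Ioc 0 a, DifferentiableAt ℝ v t := fun t ht =>
    (hasDerivAt_of_contDiffOn_Ioo hv (hsub t ht)).differentiableAt
  have hmono : StrictMonoOn (fun t => -(sin t ^ (m + 1) * deriv v t)) (Ioc 0 a) := by
    refine strictMonoOn_of_deriv_pos (convex_Ioc 0 a) (fun t ht =>
      (hasDerivAt_radial_flux hT hv hode (hsub t ht)).continuousAt.continuousWithinAt) ?_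
    rw [interior_Ioc]
    intro t ht
    have ht' := hsub t (Ioo_subset_Ioc_self ht)
    rw [(hasDerivAt_radial_flux hT hv hode ht').deriv]
    have := hsin t ht'
    have := hpos t ht
    positivity
  have hnonneg : ∀ t ∈ Ioc 0 a, 0 ≤ -(sin t ^ (m + 1) * deriv v t) := by
    intro t₀ ht₀
    by_contra! hneg
    refine false_of_deriv_le_neg_div (f := fun t => -v t) (M := M) ht₀.1 (neg_pos.2 hneg)
      (fun t ht => (hdiff t ⟨ht.1, ht.2.trans ht₀.2⟩).neg) (fun t ht => ?_)
      (hM.mono fun t h => (neg_le_abs _).trans h)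
    have hta : t ∈ Ioc 0 a := ⟨ht.1, ht.2.trans ht₀.2⟩
    have h1 := hmono.monotoneOn hta ht₀ ht.2
    have h2 := hpow t (hsub t hta)
    have h3 := pow_pos (hsin t (hsub t hta)) (m + 1)
    have h4 : 0 < deriv v t := by
      by_contra! h
      nlinarith
    rw [deriv.fun_neg, neg_le_neg_iff, div_le_iff₀ ht.1]
    nlinarith
  have hflux : ∀ t ∈ Ioc 0 a, 0 < -(sin t ^ (m + 1) * deriv v t) := by
    intro t ht
    have hm : t / 2 ∈ Ioc 0 a := ⟨half_pos ht.1, (half_le_self ht.1.le).trans ht.2⟩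
    exact (hnonneg _ hm).trans_lt (hmono hm ht (half_lt_self ht.1))
  refine ⟨hflux, ?_⟩
  rw [tendsto_order]
  refine ⟨fun e he => ?_, fun e he => ?_⟩
  · filter_upwards [Ioc_mem_nhdsGT ha.1] with t ht using he.trans (hflux t ht)
  · by_cases hex : ∃ t₀ ∈ Ioc 0 a, -(sin t₀ ^ (m + 1) * deriv v t₀) < e
    · obtain ⟨t₀, ht₀, hlt⟩ := hex
      filter_upwards [Ioc_mem_nhdsGT ht₀.1] with t ht
      exact (hmono.monotoneOn ⟨ht.1, ht.2.trans ht₀.2⟩ ht₀ ht.2).trans_lt hlt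
    · push Not at hex
      exfalso
      refine false_of_deriv_le_neg_div ha.1 he hdiff (fun t ht => ?_)
        (hM.mono fun t h => (le_abs_self _).trans h)
      have h1 := hex t ht
      have h2 := hpow t (hsub t ht)
      have h3 := pow_pos (hsin t (hsub t ht)) (m + 1)
      have h4 : deriv v t < 0 := by
        by_contra! h
        nlinarith
      rw [le_neg, div_le_iff₀ ht.1]
      nlinarith



/-- The second Dirichlet eigenvalue `τ = λ₂(h₀)` of the `m = 0` radial problem on a polar
cap of radius `θ1` exceeds the first eigenvalue `λ = λ₁(h₁)` of the `m = 1` radial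
problem; hence the second Dirichlet eigenvalue of the geodesic ball is `λ₁(h₁)`. -/
theorem second_eigenvalue_is_m_eq_one (n : ℕ) (hn : 2 ≤ n) (θ1 : ℝ)
    (hθ1 : 0 < θ1) (hθ1' : θ1 < π)
    (τ : ℝ) (hτ : 0 < τ) (v : ℝ → ℝ)
    (hv : ContDiffOn ℝ 2 v (Ioo 0 θ1))
    (hvbdd : ∃ M, ∀ᶠ θ in nhdsWithin 0 (Ioi 0), |v θ| ≤ M)
    (hvode : ∀ θ ∈ Ioo 0 θ1,
      deriv (deriv v) θ + ((n : ℝ) - 1) * Real.cot θ * deriv v θ + τ * v θ = 0)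
    (hvθ1 : Tendsto v (nhdsWithin θ1 (Iio θ1)) (nhds 0))
    (a : ℝ) (ha : a ∈ Ioo 0 θ1)
    (hvpos : ∀ θ ∈ Ioo 0 a, 0 < v θ) (hva : v a = 0)
    (hvneg : ∀ θ ∈ Ioo a θ1, v θ < 0)
    (lam : ℝ) (hlam : 0 < lam) (h : ℝ → ℝ)
    (hh : ContDiffOn ℝ 2 h (Ioo 0 θ1))
    (hhbdd : ∃ M, ∀ θ ∈ Ioo 0 θ1, |h θ| ≤ M)
    (hh0 : Tendsto h (nhdsWithin 0 (Ioi 0)) (nhds 1))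
    (hhode : ∀ θ ∈ Ioo 0 θ1,
      deriv (deriv h) θ + ((n : ℝ) - 1) * Real.cot θ * deriv h θ + lam * h θ = 0)
    (hgpos : ∀ θ ∈ Ioo 0 θ1, 0 < -(deriv h θ))
    (hg0 : Tendsto (fun θ => -(deriv h θ)) (nhdsWithin 0 (Ioi 0)) (nhds 0))
    (hgθ1 : Tendsto (fun θ => -(deriv h θ)) (nhdsWithin θ1 (Iio θ1)) (nhds 0)) :
    lam < τ := by
  obtain ⟨m, rfl⟩ := Nat.exists_eq_add_of_le' hn
  have hcast : ((m + 2 : ℕ) : ℝ) - 1 = (m : ℝ) + 1 := by push_cast; ring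
  rw [hcast] at hvode hhode
  obtain ⟨hqpos, hq0⟩ :=
    radial_flux_pos_and_tendsto_zero hθ1' hτ hv hvode hvbdd ha hvpos
  have hsin : ∀ t ∈ Ioo 0 θ1, 0 < sin t := fun t ht =>
    sin_pos_of_pos_of_lt_pi ht.1 (ht.2.trans hθ1')
  have hva' : Tendsto v (nhdsWithin a (Ioi a)) (nhds 0) := by
    have := (hasDerivAt_of_contDiffOn_Ioo hv ha).continuousAt.tendsto
    rw [hva] at this
    exact this.mono_left nhdsWithin_le_nhds
  obtain ⟨b, hb, hvb⟩ := exists_deriv_eq_zero' ha.2 hva' hvθ1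
  have hb' : b ∈ Ioo 0 θ1 := ⟨ha.1.trans hb.1, hb.2⟩
  have hanti : AntitoneOn (fun t => -(sin t ^ (m + 1) * deriv v t)) (Icc a b) := by
    have hsub : ∀ t ∈ Icc a b, t ∈ Ioo 0 θ1 := fun t ht =>
      ⟨ha.1.trans_le ht.1, ht.2.trans_lt hb.2⟩
    refine antitoneOn_of_deriv_nonpos (convex_Icc a b) (fun t ht =>
      (hasDerivAt_radial_flux hθ1' hv hvode (hsub t ht)).continuousAt.continuousWithinAt) ?_ ?_ <;>
      rw [interior_Icc]
    · exact fun t ht => (hasDerivAt_radial_flux hθ1' hv hvode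
        (hsub t (Ioo_subset_Icc_self ht))).differentiableAt.differentiableWithinAt
    · intro t ht
      have ht' := hsub t (Ioo_subset_Icc_self ht)
      rw [(hasDerivAt_radial_flux hθ1' hv hvode ht').deriv]
      exact mul_nonpos_of_nonneg_of_nonpos (mul_pos hτ (pow_pos (hsin t ht') _)).le
        (hvneg t ⟨ht.1, ht.2.trans hb.2⟩).le
  have hq : ∀ t ∈ Ioc 0 b, 0 ≤ -(sin t ^ (m + 1) * deriv v t) := by
    intro t ht
    rcases le_total t a with hta | hta
    · exact (hqpos t ⟨ht.1, hta⟩).le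
    · simpa [hvb] using hanti ⟨hta, ht.2⟩ ⟨hb.1.le, le_rfl⟩ ht.2
  by_contra! hle
  set W : ℝ → ℝ := fun t => lam * (h t * -(sin t ^ (m + 1) * deriv v t))
    - τ * (v t * -(sin t ^ (m + 1) * deriv h t)) with hWdef
  have hW : ∀ t ∈ Ioc 0 b,
      HasDerivAt W ((τ - lam) * (-deriv h t * -(sin t ^ (m + 1) * deriv v t))) t := fun t ht =>
    hasDerivAt_flux_wronskian hθ1' hv hh hvode hhode ⟨ht.1, ht.2.trans_lt hb.2⟩
  have hWanti : AntitoneOn W (Ioc 0 b) := by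
    refine antitoneOn_of_deriv_nonpos (convex_Ioc 0 b) (fun t ht =>
      (hW t ht).continuousAt.continuousWithinAt) ?_ ?_ <;> rw [interior_Ioc]
    · exact fun t ht => (hW t (Ioo_subset_Ioc_self ht)).differentiableAt.differentiableWithinAt
    · intro t ht
      rw [(hW t (Ioo_subset_Ioc_self ht)).deriv]
      exact mul_nonpos_of_nonpos_of_nonneg (sub_nonpos.2 hle)
        (mul_nonneg (hgpos t ⟨ht.1, ht.2.trans hb.2⟩).le (hq t (Ioo_subset_Ioc_self ht)))
  have hWb : 0 < W b := by
    have h1 := hvneg b hb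
    have h2 := mul_pos (pow_pos (hsin b hb') (m + 1)) (hgpos b hb')
    have h3 : W b = τ * (-v b * (sin b ^ (m + 1) * -deriv h b)) := by
      simp only [hWdef, hvb]
      ring
    rw [h3]
    exact mul_pos hτ (mul_pos (neg_pos.2 h1) h2)
  have hW0 : Tendsto W (nhdsWithin 0 (Ioi 0)) (nhds 0) := by
    have hs : Tendsto (fun t => sin t ^ (m + 1)) (nhdsWithin 0 (Ioi 0)) (nhds (sin 0 ^ (m + 1))) :=
      ((continuous_sin.pow (m + 1)).tendsto 0).mono_left nhdsWithin_le_nhds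
    have hp : Tendsto (fun t => -(sin t ^ (m + 1) * deriv h t)) (nhdsWithin 0 (Ioi 0))
        (nhds 0) := by
      simpa using hs.mul hg0
    obtain ⟨M, hM⟩ := hvbdd
    have hvp : Tendsto (fun t => v t * -(sin t ^ (m + 1) * deriv h t)) (nhdsWithin 0 (Ioi 0))
        (nhds 0) :=
      bdd_le_mul_tendsto_zero' M hM hp
    have := ((hh0.mul hq0).const_mul lam).sub (hvp.const_mul τ)
    rwa [mul_zero, mul_zero, mul_zero, sub_zero] at this
  obtain ⟨t, hlt, ht⟩ := ((hW0.eventually_lt_const hWb).and (Ioc_mem_nhdsGT hb'.1)).exists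
  exact absurd (hWanti ht ⟨hb'.1, le_rfl⟩ ht.2) (not_le.2 hlt)
end

section
/- The function θ1² λ1(θ1) is strictly decreasing on (0,π]: let n ≥ 2 and 0 < a < b ≤ π. Suppose λ_a > 0 and y_a is twice continuously differentiable and strictly positive on (0,a), bounded near 0 with (sin θ)^{n−1} y_a'(θ) → 0 as θ → 0⁺, satisfies −y_a'' − (n−1) cot θ · y_a' = λ_a y_a on (0,a), and y_a(θ) → 0 as θ → a⁻; suppose λ_b and y_b satisfy the same conditions on (0,b). Then a² λ_a > b² λ_b. -/
open Real Set Filter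

/-- `y` is a first Dirichlet eigenfunction of the geodesic ball of radius `θ1` in `S^n`
with eigenvalue `lam`: a positive, twice continuously differentiable solution of the
`m = 0` radial equation `-y'' - (n-1) cot θ · y' = λ y` on `(0,θ1)`, bounded near `0`
with `(sin θ)^(n-1) y'(θ) → 0` as `θ → 0⁺`, vanishing at `θ1`. -/
def IsFirstRadialEigenfunction (n : ℕ) (θ1 lam : ℝ) (y : ℝ → ℝ) : Prop :=
  ContDiffOn ℝ 2 y (Ioo 0 θ1) ∧
  (∀ θ ∈ Ioo 0 θ1, 0 < y θ) ∧
  (∃ M, ∀ᶠ θ in nhdsWithin 0 (Ioi 0), |y θ| ≤ M) ∧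
  Tendsto (fun θ => Real.sin θ ^ (n - 1) * deriv y θ) (nhdsWithin 0 (Ioi 0)) (nhds 0) ∧
  (∀ θ ∈ Ioo 0 θ1,
    -(deriv (deriv y) θ) - ((n : ℝ) - 1) * Real.cot θ * deriv y θ = lam * y θ) ∧
  Tendsto y (nhdsWithin θ1 (Iio θ1)) (nhds 0)

/-- A strictly increasing function on `(0, r)` with limit `0` at `0⁺` is positive. -/
lemma pos_of_strictMonoOn_of_tendsto_zero {f : ℝ → ℝ} {r : ℝ} (hf : StrictMonoOn f (Ioo 0 r))
    (h0 : Tendsto f (nhdsWithin 0 (Ioi 0)) (nhds 0)) {x : ℝ} (hx : x ∈ Ioo 0 r) : 0 < f x := by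
  have hx2 : x / 2 ∈ Ioo 0 r := ⟨half_pos hx.1, (half_lt_self hx.1).trans hx.2⟩
  refine lt_of_le_of_lt ?_ (hf hx2 hx (half_lt_self hx.1))
  refine le_of_tendsto h0 ?_
  filter_upwards [Ioo_mem_nhdsGT (half_pos hx.1)] with t ht
  exact (hf ⟨ht.1, ht.2.trans hx2.2⟩ hx2 ht.2).le

/-- A function with positive derivative on `(0, r)` and limit `0` at `0⁺` is positive. -/
lemma pos_of_hasDerivAt_pos_of_tendsto_zero {f f' : ℝ → ℝ} {r : ℝ}
    (hf : ∀ x ∈ Ioo 0 r, HasDerivAt f (f' x) x) (hf' : ∀ x ∈ Ioo 0 r, 0 < f' x)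
    (h0 : Tendsto f (nhdsWithin 0 (Ioi 0)) (nhds 0)) :
    StrictMonoOn f (Ioo 0 r) ∧ ∀ x ∈ Ioo 0 r, 0 < f x := by
  have hmono : StrictMonoOn f (Ioo 0 r) := by
    refine strictMonoOn_of_deriv_pos (convex_Ioo 0 r)
      (fun x hx => (hf x hx).continuousAt.continuousWithinAt) fun x hx => ?_
    rw [interior_Ioo] at hx
    rw [(hf x hx).deriv]
    exact hf' x hx
  exact ⟨hmono, fun x hx => pos_of_strictMonoOn_of_tendsto_zero hmono h0 hx⟩

/-- Strict monotonicity of `x ↦ x * cot x` on `(0, π)`, with denominators cleared. -/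
lemma cos_mul_sin_lt_mul_cos_mul_sin {s : ℝ} (hs0 : 0 < s) (hs1 : s < 1) {x : ℝ}
    (hx : x ∈ Ioo 0 π) :
    Real.cos x * Real.sin (s * x) < s * Real.cos (s * x) * Real.sin x := by
  have hlin (t : ℝ) : HasDerivAt (fun t => s * t) s t := by
    simpa using (hasDerivAt_id t).const_mul s
  have hd (t : ℝ) : HasDerivAt
      (fun t => s * Real.cos (s * t) * Real.sin t - Real.cos t * Real.sin (s * t))
      ((1 - s ^ 2) * (Real.sin (s * t) * Real.sin t)) t := by
    refine ((((hlin t).cos.const_mul s).mul (Real.hasDerivAt_sin t)).sub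
      ((Real.hasDerivAt_cos t).mul (hlin t).sin)).congr_deriv ?_
    ring
  refine sub_pos.1 ((pos_of_hasDerivAt_pos_of_tendsto_zero (fun t _ => hd t)
    (fun t ht => ?_) ?_).2 x hx)
  · refine mul_pos (by nlinarith) (mul_pos ?_ (Real.sin_pos_of_pos_of_lt_pi ht.1 ht.2))
    exact Real.sin_pos_of_pos_of_lt_pi (mul_pos hs0 ht.1) (by nlinarith [ht.1, ht.2])
  · simpa using (hd 0).continuousAt.tendsto.mono_left nhdsWithin_le_nhds

namespace IsFirstRadialEigenfunction

variable {k : ℕ} {r lam : ℝ} {y : ℝ → ℝ}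

lemma hasDerivAt {n : ℕ} (hy : IsFirstRadialEigenfunction n r lam y) {x : ℝ}
    (hx : x ∈ Ioo 0 r) : HasDerivAt y (deriv y x) x :=
  ((hy.1.differentiableOn (by norm_num)).differentiableAt (isOpen_Ioo.mem_nhds hx)).hasDerivAt

lemma hasDerivAt_deriv {n : ℕ} (hy : IsFirstRadialEigenfunction n r lam y) {x : ℝ}
    (hx : x ∈ Ioo 0 r) : HasDerivAt (deriv y) (deriv (deriv y) x) x := by
  have h : ContDiffOn ℝ 1 (deriv y) (Ioo 0 r) :=
    hy.1.deriv_of_isOpen isOpen_Ioo (by norm_num)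
  exact ((h.differentiableOn (by norm_num)).differentiableAt
    (isOpen_Ioo.mem_nhds hx)).hasDerivAt

lemma deriv_deriv_eq (hy : IsFirstRadialEigenfunction (k + 2) r lam y) {x : ℝ}
    (hx : x ∈ Ioo 0 r) :
    deriv (deriv y) x = -(lam * y x) - (k + 1) * (Real.cos x / Real.sin x) * deriv y x := by
  have h := hy.2.2.2.2.1 x hx
  rw [Real.cot_eq_cos_div_sin] at h
  push_cast at h
  linear_combination -h

/-- The radial equation in divergence form. -/
lemma hasDerivAt_flux (hy : IsFirstRadialEigenfunction (k + 2) r lam y) (hr : r ≤ π) {x : ℝ}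
    (hx : x ∈ Ioo 0 r) :
    HasDerivAt (fun t => Real.sin t ^ (k + 1) * deriv y t)
      (-(lam * Real.sin x ^ (k + 1) * y x)) x := by
  have hsin := (Real.sin_pos_of_pos_of_lt_pi hx.1 (hx.2.trans_le hr)).ne'
  refine (((Real.hasDerivAt_sin x).pow (k + 1)).mul (hy.hasDerivAt_deriv hx)).congr_deriv ?_
  rw [hy.deriv_deriv_eq hx]
  simp only [Nat.add_sub_cancel, Pi.pow_apply]
  push_cast
  field_simp
  ring

lemma tendsto_flux (hy : IsFirstRadialEigenfunction (k + 2) r lam y) :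
    Tendsto (fun t => Real.sin t ^ (k + 1) * deriv y t) (nhdsWithin 0 (Ioi 0)) (nhds 0) :=
  hy.2.2.2.1

lemma deriv_neg (hy : IsFirstRadialEigenfunction (k + 2) r lam y) (hr : r ≤ π) (hlam : 0 < lam)
    {x : ℝ} (hx : x ∈ Ioo 0 r) : deriv y x < 0 := by
  have hsin : ∀ t ∈ Ioo 0 r, 0 < Real.sin t ^ (k + 1) := fun t ht =>
    pow_pos (Real.sin_pos_of_pos_of_lt_pi ht.1 (ht.2.trans_le hr)) _
  have h := (pos_of_hasDerivAt_pos_of_tendsto_zero (fun t ht => (hy.hasDerivAt_flux hr ht).neg)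
    (fun t ht => ?_) (by simpa only [neg_zero] using! hy.tendsto_flux.neg)).2 x hx
  · simp only [Pi.neg_apply] at h
    nlinarith [hsin x hx]
  · rw [neg_neg]
    exact mul_pos (mul_pos hlam (hsin t ht)) (hy.2.1 t ht)

lemma exists_bound (hy : IsFirstRadialEigenfunction (k + 2) r lam y) (hr : r ≤ π)
    (hlam : 0 < lam) : ∃ M, ∀ x ∈ Ioo 0 r, y x ≤ M := by
  have hanti : StrictAntiOn y (Ioo 0 r) := by
    refine strictAntiOn_of_deriv_neg (convex_Ioo 0 r)
      (fun x hx => (hy.hasDerivAt hx).continuousAt.continuousWithinAt) fun x hx => ?_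
    rw [interior_Ioo] at hx
    exact hy.deriv_neg hr hlam hx
  obtain ⟨M, hM⟩ := hy.2.2.1
  refine ⟨M, fun x hx => ?_⟩
  obtain ⟨t, ht, htx⟩ := (hM.and (Ioo_mem_nhdsGT hx.1)).exists
  exact ((hanti ⟨htx.1, htx.2.trans hx.2⟩ hx htx.2).le.trans (le_abs_self _)).trans ht

lemma exists_flux_bound (hy : IsFirstRadialEigenfunction (k + 2) r lam y) (hr : r ≤ π)
    (hlam : 0 < lam) : ∃ C, ∀ x ∈ Ioo 0 r, -(Real.sin x ^ (k + 1) * deriv y x) ≤ C := by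
  obtain ⟨M, hM⟩ := hy.exists_bound hr hlam
  refine ⟨lam * (|M| + 1) * r, fun x hx => ?_⟩
  have hd (t : ℝ) : HasDerivAt (fun t => lam * (|M| + 1) * t) (lam * (|M| + 1)) t := by
    simpa using (hasDerivAt_id t).const_mul (lam * (|M| + 1))
  have h := (pos_of_hasDerivAt_pos_of_tendsto_zero
    (fun t ht => (hy.hasDerivAt_flux hr ht).add (hd t)) (fun t ht => ?_) ?_).2 x hx
  · simp only [Pi.add_apply] at h
    have : lam * (|M| + 1) * x ≤ lam * (|M| + 1) * r :=
      mul_le_mul_of_nonneg_left hx.2.le (by positivity)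
    linarith
  · have hsin := Real.sin_pos_of_pos_of_lt_pi ht.1 (ht.2.trans_le hr)
    have h1 : Real.sin t ^ (k + 1) * y t ≤ 1 * y t :=
      mul_le_mul_of_nonneg_right (pow_le_one₀ hsin.le (Real.sin_le_one t)) (hy.2.1 t ht).le
    have h2 : Real.sin t ^ (k + 1) * y t < |M| + 1 := by
      linarith [hM t ht, le_abs_self M]
    nlinarith
  · have h0 := hy.tendsto_flux.add ((hd 0).continuousAt.tendsto.mono_left nhdsWithin_le_nhds)
    simpa only [mul_zero, add_zero] using! h0

/-- Derivative of the weighted Wronskian of a rescaled eigenfunction and another one. -/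
lemma hasDerivAt_wronskian {a b lama lamb s : ℝ} {ya yb : ℝ → ℝ}
    (hya : IsFirstRadialEigenfunction (k + 2) a lama ya)
    (hyb : IsFirstRadialEigenfunction (k + 2) b lamb yb) (ha : a ≤ π) (hb : b ≤ π) {x : ℝ}
    (hxa : s * x ∈ Ioo 0 a) (hxb : x ∈ Ioo 0 b) :
    HasDerivAt (fun t => Real.sin t ^ (k + 1) * (s * deriv ya (s * t)) * yb t -
        ya (s * t) * (Real.sin t ^ (k + 1) * deriv yb t))
      ((k + 1) * s * Real.sin x ^ k / Real.sin (s * x) * yb x * -deriv ya (s * x) *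
          (s * Real.cos (s * x) * Real.sin x - Real.cos x * Real.sin (s * x)) +
        (lamb - s ^ 2 * lama) * (Real.sin x ^ (k + 1) * ya (s * x) * yb x)) x := by
  have hlin : HasDerivAt (fun t => s * t) s x := by
    simpa using (hasDerivAt_id x).const_mul s
  have hsin := (Real.sin_pos_of_pos_of_lt_pi hxa.1 (hxa.2.trans_le ha)).ne'
  have hz : HasDerivAt (fun t => ya (s * t)) (deriv ya (s * x) * s) x :=
    (hya.hasDerivAt hxa).comp x hlin
  have hz' : HasDerivAt (fun t => deriv ya (s * t)) (deriv (deriv ya) (s * x) * s) x :=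
    (hya.hasDerivAt_deriv hxa).comp x hlin
  refine (((((Real.hasDerivAt_sin x).pow (k + 1)).mul (hz'.const_mul s)).mul
    (hyb.hasDerivAt hxb)).sub (hz.mul (hyb.hasDerivAt_flux hb hxb))).congr_deriv ?_
  rw [hya.deriv_deriv_eq hxa]
  simp only [Nat.add_sub_cancel, Pi.pow_apply, Pi.mul_apply]
  push_cast
  field_simp
  ring

lemma tendsto_wronskian {a b lama lamb s : ℝ} {ya yb : ℝ → ℝ}
    (hya : IsFirstRadialEigenfunction (k + 2) a lama ya)
    (hyb : IsFirstRadialEigenfunction (k + 2) b lamb yb) (hs0 : 0 < s) (hs1 : s ≤ 1) :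
    Tendsto (fun t => Real.sin t ^ (k + 1) * (s * deriv ya (s * t)) * yb t -
        ya (s * t) * (Real.sin t ^ (k + 1) * deriv yb t)) (nhdsWithin 0 (Ioi 0)) (nhds 0) := by
  have hscale : Tendsto (fun t => s * t) (nhdsWithin 0 (Ioi 0)) (nhdsWithin 0 (Ioi 0)) := by
    refine tendsto_nhdsWithin_iff.2 ⟨?_, ?_⟩
    · have : Tendsto (fun t => s * t) (nhds 0) (nhds (s * 0)) :=
        (continuous_const_mul s).tendsto 0
      rw [mul_zero] at this
      exact this.mono_left nhdsWithin_le_nhds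
    · filter_upwards [self_mem_nhdsWithin] with t ht
      exact mul_pos hs0 ht
  have hflux : Tendsto (fun t => Real.sin t ^ (k + 1) * (s * deriv ya (s * t)))
      (nhdsWithin 0 (Ioi 0)) (nhds 0) := by
    have hlim := (((hya.tendsto_flux.comp hscale).abs).const_mul ((s ^ k)⁻¹))
    simp only [abs_zero, mul_zero] at hlim
    refine squeeze_zero_norm' ?_ hlim
    filter_upwards [Ioo_mem_nhdsGT Real.pi_pos] with t ht
    have hsin := Real.sin_pos_of_pos_of_lt_pi ht.1 ht.2
    have hconc : s * Real.sin t ≤ Real.sin (s * t) := by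
      have := strictConcaveOn_sin_Icc.concaveOn.2 (x := 0) (y := t)
        ⟨le_rfl, Real.pi_pos.le⟩ ⟨ht.1.le, ht.2.le⟩ (sub_nonneg.2 hs1) hs0.le (by ring)
      simpa using this
    have hpow : (s * Real.sin t) ^ (k + 1) ≤ Real.sin (s * t) ^ (k + 1) :=
      pow_le_pow_left₀ (by positivity) hconc _
    have hsin' : 0 < Real.sin (s * t) := lt_of_lt_of_le (by positivity) hconc
    simp only [Function.comp_apply, Real.norm_eq_abs, abs_mul, abs_pow, abs_of_pos hsin,
      abs_of_pos hsin', abs_of_pos hs0]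
    calc Real.sin t ^ (k + 1) * (s * |deriv ya (s * t)|)
        = (s ^ k)⁻¹ * ((s * Real.sin t) ^ (k + 1) * |deriv ya (s * t)|) := by
          field_simp
          ring
      _ ≤ _ := by gcongr
  have bdd {f : ℝ → ℝ} (hf : ∃ M, ∀ᶠ t in nhdsWithin 0 (Ioi 0), |f t| ≤ M) :
      IsBoundedUnder (· ≤ ·) (nhdsWithin 0 (Ioi 0)) (norm ∘ f) := by
    obtain ⟨M, hM⟩ := hf
    exact ⟨M, eventually_map.2 hM⟩
  have hz : ∃ M, ∀ᶠ t in nhdsWithin 0 (Ioi 0), |ya (s * t)| ≤ M := by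
    obtain ⟨M, hM⟩ := hya.2.2.1
    exact ⟨M, hscale.eventually hM⟩
  simpa using (hflux.zero_mul_isBoundedUnder_le (bdd hyb.2.2.1)).sub
    (isBoundedUnder_le_mul_tendsto_zero (bdd hz) hyb.tendsto_flux)

end IsFirstRadialEigenfunction

/-- The function `θ1² λ₁(θ1)` is strictly decreasing for geodesic balls in `S^n`,
`0 < θ1 ≤ π`. -/
theorem sq_radius_mul_first_eigenvalue_strictAnti (n : ℕ) (hn : 2 ≤ n)
    (a b : ℝ) (ha : 0 < a) (hab : a < b) (hb : b ≤ π)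
    (lama lamb : ℝ) (hlama : 0 < lama) (hlamb : 0 < lamb)
    (ya yb : ℝ → ℝ)
    (hya : IsFirstRadialEigenfunction n a lama ya)
    (hyb : IsFirstRadialEigenfunction n b lamb yb) :
    b ^ 2 * lamb < a ^ 2 * lama := by
  obtain ⟨k, rfl⟩ := Nat.exists_eq_add_of_le' hn
  have hb0 : 0 < b := ha.trans hab
  have ha' : a ≤ π := hab.le.trans hb
  by_contra! hle
  obtain ⟨s, rfl⟩ : ∃ s, a = s * b := ⟨a / b, by field_simp⟩
  have hs0 : 0 < s := pos_of_mul_pos_left ha hb0.le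
  have hs1 : s < 1 := by
    by_contra! h
    nlinarith
  have hlam : s ^ 2 * lama ≤ lamb := by
    have : b ^ 2 * (s ^ 2 * lama) ≤ b ^ 2 * lamb := by linarith
    exact le_of_mul_le_mul_left this (by positivity)
  have hmem : ∀ t ∈ Ioo 0 b, s * t ∈ Ioo 0 (s * b) := fun t ht =>
    ⟨mul_pos hs0 ht.1, mul_lt_mul_of_pos_left ht.2 hs0⟩
  have hwronskian := pos_of_hasDerivAt_pos_of_tendsto_zero
    (fun t ht => hya.hasDerivAt_wronskian hyb ha' hb (hmem t ht) ht) (fun t ht => ?_)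
    (hya.tendsto_wronskian hyb hs0 hs1.le)
  · obtain ⟨hmono, hpos⟩ := hwronskian
    obtain ⟨C, hC⟩ := hyb.exists_flux_bound hb hlamb
    have hhalf : b / 2 ∈ Ioo 0 b := ⟨half_pos hb0, half_lt_self hb0⟩
    have hc := hpos _ hhalf
    set W := fun t => Real.sin t ^ (k + 1) * (s * deriv ya (s * t)) * yb t -
      ya (s * t) * (Real.sin t ^ (k + 1) * deriv yb t)
    have hscale : Tendsto (fun t => s * t) (nhdsWithin b (Iio b))
        (nhdsWithin (s * b) (Iio (s * b))) := by
      refine tendsto_nhdsWithin_iff.2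
        ⟨((continuous_const_mul s).tendsto b).mono_left nhdsWithin_le_nhds, ?_⟩
      filter_upwards [self_mem_nhdsWithin] with t ht
      exact mul_lt_mul_of_pos_left ht hs0
    have hlim : Tendsto (fun t => ya (s * t) * C) (nhdsWithin b (Iio b)) (nhds 0) := by
      simpa using (hya.2.2.2.2.2.comp hscale).mul_const C
    refine hc.not_ge (ge_of_tendsto hlim ?_)
    filter_upwards [Ioo_mem_nhdsLT hhalf.2] with t ht
    have htb : t ∈ Ioo 0 b := ⟨hhalf.1.trans ht.1, ht.2⟩
    have hsin := Real.sin_pos_of_pos_of_lt_pi htb.1 (htb.2.trans_le hb)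
    have h1 : Real.sin t ^ (k + 1) * (s * deriv ya (s * t)) * yb t ≤ 0 := by
      refine mul_nonpos_of_nonpos_of_nonneg (mul_nonpos_of_nonneg_of_nonpos (by positivity) ?_)
        (hyb.2.1 t htb).le
      exact mul_nonpos_of_nonneg_of_nonpos hs0.le (hya.deriv_neg ha' hlama (hmem t htb)).le
    have h2 := mul_le_mul_of_nonneg_left (hC t htb) (hya.2.1 _ (hmem t htb)).le
    have h3 : W (b / 2) < W t := hmono hhalf htb ht.1
    have h4 : W t = Real.sin t ^ (k + 1) * (s * deriv ya (s * t)) * yb t -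
      ya (s * t) * (Real.sin t ^ (k + 1) * deriv yb t) := rfl
    linarith
  · have htπ : t ∈ Ioo 0 π := ⟨ht.1, ht.2.trans_le hb⟩
    have hsin := Real.sin_pos_of_pos_of_lt_pi htπ.1 htπ.2
    have hsin' := Real.sin_pos_of_pos_of_lt_pi (hmem t ht).1 ((hmem t ht).2.trans_le ha')
    have hyb0 := hyb.2.1 t ht
    have hya0 := hya.2.1 _ (hmem t ht)
    have hder := neg_pos.2 (hya.deriv_neg ha' hlama (hmem t ht))
    have hcot := sub_pos.2 (cos_mul_sin_lt_mul_cos_mul_sin hs0 hs1 htπ)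
    have hgap := sub_nonneg.2 hlam
    exact add_pos_of_pos_of_nonneg (mul_pos (mul_pos (by positivity) hder) hcot)
      (mul_nonneg hgap (by positivity))
end

section
/- The ratio λ2/λ1 for geodesic balls is strictly increasing on (0,π/2]: let n ≥ 2 and 0 < a < b ≤ π/2. For each radius r ∈ {a,b}, suppose λ1(r) > 0 admits a solution y1 of −y'' − (n−1) cot θ · y' = λ1(r) y on (0,r) that is strictly positive on (0,r), bounded near 0 with (sin θ)^{n−1} y1'(θ) → 0 as θ → 0⁺, and tends to 0 at r (a first eigenfunction of the m = 0 problem), and suppose λ2(r) > 0 admits a solution y2 of −y'' − (n−1) cot θ · y' + (n−1)(sin θ)^{-2} y = λ2(r) y on (0,r) that is strictly positive on (0,r) and tends to 0 at 0 and at r (a first eigenfunction of the m = 1 problem). Then λ2(a)/λ1(a) < λ2(b)/λ1(b). -/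
open Real Set Filter


/-- `y` is a first eigenfunction of the `m = 1` radial problem on `(0,θ1)` (so `lam` is
the second Dirichlet eigenvalue of the geodesic ball of radius `θ1` in `S^n`): a
positive, twice continuously differentiable solution of
`-y'' - (n-1) cot θ · y' + (n-1) y / sin²θ = λ y` vanishing at `0` and at `θ1`. -/
def IsSecondRadialEigenfunction (n : ℕ) (θ1 lam : ℝ) (y : ℝ → ℝ) : Prop :=
  ContDiffOn ℝ 2 y (Ioo 0 θ1) ∧
  (∀ θ ∈ Ioo 0 θ1, 0 < y θ) ∧
  (∀ θ ∈ Ioo 0 θ1,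
    -(deriv (deriv y) θ) - ((n : ℝ) - 1) * Real.cot θ * deriv y θ
      + ((n : ℝ) - 1) * y θ / Real.sin θ ^ 2 = lam * y θ) ∧
  Tendsto y (nhdsWithin 0 (Ioi 0)) (nhds 0) ∧
  Tendsto y (nhdsWithin θ1 (Iio θ1)) (nhds 0)


/-- A positive solution of `w'' = V w` on `(-∞, S)`, with `w` bounded and `w' → 0` at `-∞`,
and `w → 0` with `w'` bounded at `S`. -/
structure IsPosSolution (V : ℝ → ℝ) (S : ℝ) (w w' : ℝ → ℝ) : Prop where
  hasDerivAt : ∀ s < S, HasDerivAt w (w' s) s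
  hasDerivAt' : ∀ s < S, HasDerivAt w' (V s * w s) s
  pos : ∀ s < S, 0 < w s
  bdd_atBot : ∃ M, ∀ᶠ s in atBot, |w s| ≤ M
  tendsto_deriv_atBot : Tendsto w' atBot (nhds 0)
  tendsto_end : Tendsto w (nhdsWithin S (Iio S)) (nhds 0)
  bdd_deriv_end : ∃ M, ∀ᶠ s in nhdsWithin S (Iio S), |w' s| ≤ M

theorem tendsto_mul_zero_of_eventually_abs_le {l : Filter ℝ} {f g : ℝ → ℝ}
    (hf : ∃ M, ∀ᶠ s in l, |f s| ≤ M) (hg : Tendsto g l (nhds 0)) :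
    Tendsto (fun s => f s * g s) l (nhds 0) := by
  obtain ⟨M, hM⟩ := hf
  exact bdd_le_mul_tendsto_zero' M hM hg

namespace IsPosSolution

variable {V V₁ V₂ w w' w₁ w₁' w₂ w₂' : ℝ → ℝ} {S : ℝ}

theorem comp_add (h : IsPosSolution V S w w') (δ : ℝ) :
    IsPosSolution (fun s => V (s + δ)) (S - δ) (fun s => w (s + δ)) (fun s => w' (s + δ)) := by
  have hbot : Tendsto (fun s : ℝ => s + δ) atBot atBot := tendsto_atBot_add_const_right _ _ tendsto_id
  have hend : Tendsto (fun s : ℝ => s + δ) (nhdsWithin (S - δ) (Iio (S - δ)))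
      (nhdsWithin S (Iio S)) := by
    refine tendsto_nhdsWithin_iff.2 ⟨?_, ?_⟩
    · have : Tendsto (fun s : ℝ => s + δ) (nhds (S - δ)) (nhds (S - δ + δ)) :=
        (continuous_id.add continuous_const).tendsto _
      rw [sub_add_cancel] at this
      exact this.mono_left nhdsWithin_le_nhds
    · filter_upwards [self_mem_nhdsWithin] with s hs
      simp only [mem_Iio] at *
      linarith
  refine ⟨fun s hs => ?_, fun s hs => ?_, fun s hs => h.pos _ (by linarith), ?_,
    h.tendsto_deriv_atBot.comp hbot, h.tendsto_end.comp hend, ?_⟩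
  · exact (h.hasDerivAt (s + δ) (by linarith)).comp_add_const s δ
  · exact (h.hasDerivAt' (s + δ) (by linarith)).comp_add_const s δ
  · obtain ⟨M, hM⟩ := h.bdd_atBot
    exact ⟨M, hbot.eventually hM⟩
  · obtain ⟨M, hM⟩ := h.bdd_deriv_end
    exact ⟨M, hend.eventually hM⟩

theorem hasDerivAt_wronskian (h₁ : IsPosSolution V₁ S w₁ w₁') (h₂ : IsPosSolution V₂ S w₂ w₂')
    {s : ℝ} (hs : s < S) :
    HasDerivAt (fun s => w₁ s * w₂' s - w₂ s * w₁' s) ((V₂ s - V₁ s) * (w₁ s * w₂ s)) s := by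
  refine (((h₁.hasDerivAt s hs).mul (h₂.hasDerivAt' s hs)).sub
    ((h₂.hasDerivAt s hs).mul (h₁.hasDerivAt' s hs))).congr_deriv ?_
  ring

theorem tendsto_wronskian_atBot (h₁ : IsPosSolution V₁ S w₁ w₁')
    (h₂ : IsPosSolution V₂ S w₂ w₂') :
    Tendsto (fun s => w₁ s * w₂' s - w₂ s * w₁' s) atBot (nhds 0) := by
  simpa using (tendsto_mul_zero_of_eventually_abs_le h₁.bdd_atBot h₂.tendsto_deriv_atBot).sub
    (tendsto_mul_zero_of_eventually_abs_le h₂.bdd_atBot h₁.tendsto_deriv_atBot)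

theorem tendsto_wronskian_end (h₁ : IsPosSolution V₁ S w₁ w₁')
    (h₂ : IsPosSolution V₂ S w₂ w₂') :
    Tendsto (fun s => w₁ s * w₂' s - w₂ s * w₁' s) (nhdsWithin S (Iio S)) (nhds 0) := by
  simpa [mul_comm] using
    (tendsto_mul_zero_of_eventually_abs_le h₂.bdd_deriv_end h₁.tendsto_end).sub
    (tendsto_mul_zero_of_eventually_abs_le h₁.bdd_deriv_end h₂.tendsto_end)

end IsPosSolution

theorem exists_hasDerivAt_eq_zero_Iio {f f' : ℝ → ℝ} {S : ℝ}
    (hf : ∀ s < S, HasDerivAt f (f' s) s) (h₀ : Tendsto f atBot (nhds 0))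
    (h₁ : Tendsto f (nhdsWithin S (Iio S)) (nhds 0)) : ∃ s < S, f' s = 0 := by
  have hlt : ∀ x ∈ Ioo 0 (exp S), log x < S := fun x hx => (log_lt_iff_lt_exp hx.1).2 hx.2
  have hlog : Tendsto log (nhdsWithin (exp S) (Iio (exp S))) (nhdsWithin S (Iio S)) := by
    refine tendsto_nhdsWithin_iff.2 ⟨?_, ?_⟩
    · have := (continuousAt_log (exp_pos S).ne').tendsto
      rw [log_exp] at this
      exact this.mono_left nhdsWithin_le_nhds
    · filter_upwards [Ioo_mem_nhdsLT (exp_pos S)] with x hx using hlt x hx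
  obtain ⟨x, hx, hx0⟩ := exists_hasDerivAt_eq_zero' (f := fun x => f (log x))
    (f' := fun x => f' (log x) * x⁻¹) (exp_pos S) (h₀.comp tendsto_log_nhdsGT_zero)
    (h₁.comp hlog) (fun x hx => (hf _ (hlt x hx)).comp x (hasDerivAt_log hx.1.ne'))
  exact ⟨log x, hlt x hx, by simpa [hx.1.ne'] using hx0⟩

theorem pos_of_hasDerivAt_pos_of_tendsto_atBot {f f' : ℝ → ℝ} {t : ℝ}
    (hf : ∀ s ≤ t, HasDerivAt f (f' s) s) (h : ∀ s < t, 0 < f' s)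
    (h₀ : Tendsto f atBot (nhds 0)) {s : ℝ} (hs : s ≤ t) : 0 < f s := by
  have hmono : StrictMonoOn f (Iic t) := by
    refine strictMonoOn_of_deriv_pos (convex_Iic t)
      (fun x hx => (hf x hx).continuousAt.continuousWithinAt) fun x hx => ?_
    rw [interior_Iic] at hx
    rw [(hf x (le_of_lt hx)).deriv]
    exact h x hx
  have h1 : 0 ≤ f (s - 1) := by
    refine le_of_tendsto h₀ ?_
    filter_upwards [Iic_mem_atBot (s - 1)] with x hx
    simp only [mem_Iic] at hx
    exact hmono.monotoneOn (by simp only [mem_Iic]; linarith) (by simp only [mem_Iic]; linarith) hx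
  exact h1.trans_lt (hmono (by simp only [mem_Iic]; linarith) hs (by linarith))

theorem pos_of_hasDerivAt_neg_of_tendsto_end {f f' : ℝ → ℝ} {t S : ℝ}
    (hf : ∀ s ∈ Ico t S, HasDerivAt f (f' s) s) (h : ∀ s ∈ Ioo t S, f' s < 0)
    (h₁ : Tendsto f (nhdsWithin S (Iio S)) (nhds 0)) {s : ℝ} (hs : s ∈ Ico t S) : 0 < f s := by
  have hmono : StrictAntiOn f (Ico t S) := by
    refine strictAntiOn_of_deriv_neg (convex_Ico t S)
      (fun x hx => (hf x hx).continuousAt.continuousWithinAt) fun x hx => ?_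
    rw [interior_Ico] at hx
    rw [(hf x (Ioo_subset_Ico_self hx)).deriv]
    exact h x hx
  obtain ⟨r, hr⟩ := exists_between hs.2
  have hr' : r ∈ Ico t S := ⟨hs.1.trans hr.1.le, hr.2⟩
  have h1 : 0 ≤ f r := by
    refine le_of_tendsto h₁ ?_
    filter_upwards [Ioo_mem_nhdsLT hr.2] with x hx
    exact hmono.antitoneOn hr' ⟨hr'.1.trans hx.1.le, hx.2⟩ hx.1.le
  exact h1.trans_lt (hmono hs hr' hr.1)

theorem cosh_lt_cosh_of_lt_of_nonpos {s t : ℝ} (hst : s < t) (ht : t ≤ 0) : cosh t < cosh s := by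
  rw [cosh_lt_cosh, abs_of_nonpos ht, abs_of_neg (hst.trans_le ht)]
  linarith

theorem strictAnti_cosh_div_cosh_add {δ : ℝ} (hδ : 0 < δ) :
    StrictAnti fun s => cosh s / cosh (s + δ) := by
  intro s t hst
  rw [div_lt_div_iff₀ (cosh_pos _) (cosh_pos _)]
  have h := mul_pos (sinh_pos_iff.2 (sub_pos.2 hst)) (sinh_pos_iff.2 hδ)
  have h2 : cosh s * cosh (t + δ) - cosh t * cosh (s + δ) = sinh (t - s) * sinh δ := by
    rw [cosh_add, cosh_add, sinh_sub]
    ring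
  linarith

/-- The potential of the radial equation in the variable `s = log (tan (θ / 2))`. -/
noncomputable def sechPotential (m κ s : ℝ) : ℝ := m ^ 2 - κ / cosh s ^ 2

theorem sechPotential_lt_and_strictMonoOn_div {h κ₁ κ₂ S : ℝ} (hh : 0 ≤ h) (hS : S ≤ 0)
    {w₁ w₁' w₂ w₂' : ℝ → ℝ} (h₁ : IsPosSolution (sechPotential h κ₁) S w₁ w₁')
    (h₂ : IsPosSolution (sechPotential (h + 1) κ₂) S w₂ w₂') :
    κ₁ < κ₂ ∧ StrictMonoOn (fun s => w₂ s / w₁ s) (Iio S) := by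
  have hd := fun s (hs : s < S) => h₁.hasDerivAt_wronskian h₂ hs
  have hB := h₁.tendsto_wronskian_atBot h₂
  have hE := h₁.tendsto_wronskian_end h₂
  have hV : ∀ s, sechPotential (h + 1) κ₂ s - sechPotential h κ₁ s
      = 2 * h + 1 - (κ₂ - κ₁) / cosh s ^ 2 := fun s => by
    simp only [sechPotential]
    ring
  obtain ⟨t, ht, ht0⟩ := exists_hasDerivAt_eq_zero_Iio hd hB hE
  have hp : ∀ s < S, 0 < w₁ s * w₂ s := fun s hs => mul_pos (h₁.pos s hs) (h₂.pos s hs)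
  rw [mul_eq_zero, or_iff_left (hp t ht).ne', hV] at ht0
  have hcosh : ∀ s, 0 < cosh s ^ 2 := fun s => pow_pos (cosh_pos s) 2
  have hκ : 0 < κ₂ - κ₁ := by
    have h3 : (κ₂ - κ₁) / cosh t ^ 2 = 2 * h + 1 := by linarith
    rw [div_eq_iff (hcosh t).ne'] at h3
    rw [h3]
    exact mul_pos (by linarith) (hcosh t)
  have hanti : ∀ s r, s < r → r ≤ 0 → (κ₂ - κ₁) / cosh s ^ 2 < (κ₂ - κ₁) / cosh r ^ 2 :=
    fun s r hsr hr => div_lt_div_of_pos_left hκ (hcosh r)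
      (pow_lt_pow_left₀ (cosh_lt_cosh_of_lt_of_nonpos hsr hr) (cosh_pos r).le two_ne_zero)
  have hW : ∀ s < S, 0 < w₁ s * w₂' s - w₂ s * w₁' s := by
    intro s hs
    rcases le_or_gt s t with hst | hst
    · refine pos_of_hasDerivAt_pos_of_tendsto_atBot (fun x hx => hd x (hx.trans_lt ht))
        (fun x hx => mul_pos ?_ (hp x (hx.trans ht))) hB hst
      rw [hV]
      linarith [hanti x t hx (ht.le.trans hS)]
    · refine pos_of_hasDerivAt_neg_of_tendsto_end (fun x hx => hd x hx.2)
        (fun x hx => mul_neg_of_neg_of_pos ?_ (hp x hx.2)) hE ⟨hst.le, hs⟩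
      rw [hV]
      linarith [hanti t x hx.1 (hx.2.le.trans hS)]
  refine ⟨by linarith, ?_⟩
  have hq : ∀ s < S, HasDerivAt (fun s => w₂ s / w₁ s)
      ((w₂' s * w₁ s - w₂ s * w₁' s) / w₁ s ^ 2) s := fun s hs =>
    (h₂.hasDerivAt s hs).div (h₁.hasDerivAt s hs) (h₁.pos s hs).ne'
  refine strictMonoOn_of_deriv_pos (convex_Iio S)
    (fun x hx => (hq x hx).continuousAt.continuousWithinAt) fun x hx => ?_
  rw [interior_Iio] at hx
  rw [(hq x hx).deriv]
  have := h₁.pos x hx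
  exact div_pos (by linarith [hW x hx]) (by positivity)

theorem sechPotential_ratio_lt {h A B κ₁a κ₂a κ₁b κ₂b : ℝ} (hh : 0 ≤ h) (hAB : A < B) (hB : B ≤ 0)
    (h₁b : 0 < κ₁b) (h₂b : 0 < κ₂b)
    {u₁ u₁' u₂ u₂' v₁ v₁' v₂ v₂' : ℝ → ℝ}
    (hu₁ : IsPosSolution (sechPotential h κ₁a) A u₁ u₁')
    (hu₂ : IsPosSolution (sechPotential (h + 1) κ₂a) A u₂ u₂')
    (hv₁ : IsPosSolution (sechPotential h κ₁b) B v₁ v₁')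
    (hv₂ : IsPosSolution (sechPotential (h + 1) κ₂b) B v₂ v₂') :
    κ₂a / κ₂b < κ₁a / κ₁b ∧ 1 < κ₁a / κ₁b := by
  obtain ⟨δ, rfl⟩ : ∃ δ, B = A + δ := ⟨B - A, by ring⟩
  have hδ : 0 < δ := by linarith
  have hqa := (sechPotential_lt_and_strictMonoOn_div hh (by linarith) hu₁ hu₂).2
  have hqb := (sechPotential_lt_and_strictMonoOn_div hh hB hv₁ hv₂).2
  have hv₁s := hv₁.comp_add δ
  have hv₂s := hv₂.comp_add δ
  rw [add_sub_cancel_right] at hv₁s hv₂s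
  have hd₁ := fun s (hs : s < A) => hv₁s.hasDerivAt_wronskian hu₁ hs
  have hd₂ := fun s (hs : s < A) => hv₂s.hasDerivAt_wronskian hu₂ hs
  have hV : ∀ {m κ κ' : ℝ} (s : ℝ), 0 < κ' →
      sechPotential m κ s - sechPotential m κ' (s + δ)
        = κ' / cosh s ^ 2 * ((cosh s / cosh (s + δ)) ^ 2 - κ / κ') := fun s hκ => by
    have := (cosh_pos s).ne'
    have := (cosh_pos (s + δ)).ne'
    simp only [sechPotential]
    field_simp
    ring
  obtain ⟨t, ht, ht0⟩ := exists_hasDerivAt_eq_zero_Iio hd₁ (hv₁s.tendsto_wronskian_atBot hu₁)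
    (hv₁s.tendsto_wronskian_end hu₁)
  have hf₁ : ∀ s < A, 0 < v₁ (s + δ) * u₁ s := fun s hs => mul_pos (hv₁s.pos s hs) (hu₁.pos s hs)
  have hf₂ : ∀ s < A, 0 < v₂ (s + δ) * u₂ s := fun s hs => mul_pos (hv₂s.pos s hs) (hu₂.pos s hs)
  have hcosh : ∀ s, 0 < cosh s ^ 2 := fun s => pow_pos (cosh_pos s) 2
  rw [mul_eq_zero, or_iff_left (hf₁ t ht).ne', hV t h₁b, mul_eq_zero,
    or_iff_right (div_pos h₁b (hcosh t)).ne', sub_eq_zero] at ht0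
  have hanti : ∀ s r, s < r → (cosh r / cosh (r + δ)) ^ 2 < (cosh s / cosh (s + δ)) ^ 2 :=
    fun s r hsr => pow_lt_pow_left₀ (strictAnti_cosh_div_cosh_add hδ hsr)
      (div_pos (cosh_pos _) (cosh_pos _)).le two_ne_zero
  refine ⟨?_, ?_⟩
  swap
  · rw [← ht0]
    refine one_lt_pow₀ ((one_lt_div (cosh_pos _)).2 ?_) two_ne_zero
    exact cosh_lt_cosh_of_lt_of_nonpos (by linarith) (by linarith)
  by_contra! hle
  set Q : ℝ → ℝ := fun s => (v₂ (s + δ) * u₂ s) / (v₁ (s + δ) * u₁ s) with hQ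
  have hQmono : StrictMonoOn Q (Iio A) := by
    intro s hs r hr hsr
    have e : ∀ s, Q s = (v₂ (s + δ) / v₁ (s + δ)) * (u₂ s / u₁ s) := fun s => by
      simp only [hQ]
      rw [mul_div_mul_comm]
    simp only [mem_Iio] at hs hr
    rw [e, e]
    have i1 := hqa hs hr hsr
    have i2 := hqb (show s + δ ∈ Iio (A + δ) by simpa using hs)
      (show r + δ ∈ Iio (A + δ) by simpa using hr) (by linarith)
    have := div_pos (hv₂s.pos s hs) (hv₁s.pos s hs)
    have := div_pos (hu₂.pos s hs) (hu₁.pos s hs)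
    simp only at i1 i2
    gcongr
  set G : ℝ → ℝ := fun s => (v₂ (s + δ) * u₂' s - u₂ s * v₂' (s + δ)) / κ₂b
    - Q t * ((v₁ (s + δ) * u₁' s - u₁ s * v₁' (s + δ)) / κ₁b) with hG
  set G' : ℝ → ℝ := fun s => v₁ (s + δ) * u₁ s / cosh s ^ 2 *
    (Q s * ((cosh s / cosh (s + δ)) ^ 2 - κ₂a / κ₂b)
      - Q t * ((cosh s / cosh (s + δ)) ^ 2 - κ₁a / κ₁b)) with hG'
  have hGd : ∀ s < A, HasDerivAt G (G' s) s := by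
    intro s hs
    refine (((hd₂ s hs).div_const κ₂b).sub
      (((hd₁ s hs).div_const κ₁b).const_mul (Q t))).congr_deriv ?_
    have e : v₂ (s + δ) * u₂ s = Q s * (v₁ (s + δ) * u₁ s) := by
      simp only [hQ]
      rw [div_mul_cancel₀ _ (hf₁ s hs).ne']
    rw [hV s h₁b, hV s h₂b, e]
    simp only [hG']
    field_simp
  have hQpos : ∀ s < A, 0 < Q s := fun s hs => div_pos (hf₂ s hs) (hf₁ s hs)
  have hGneg : ∀ s < A, s ≠ t → G' s < 0 := by
    intro s hs hst
    refine mul_neg_of_pos_of_neg (div_pos (hf₁ s hs) (hcosh s)) ?_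
    have e1 : Q s * ((cosh s / cosh (s + δ)) ^ 2 - κ₂a / κ₂b)
        ≤ Q s * ((cosh s / cosh (s + δ)) ^ 2 - κ₁a / κ₁b) :=
      mul_le_mul_of_nonneg_left (by linarith) (hQpos s hs).le
    have e2 : (Q s - Q t) * ((cosh s / cosh (s + δ)) ^ 2 - κ₁a / κ₁b) < 0 := by
      rcases lt_or_gt_of_ne hst with h | h
      · exact mul_neg_of_neg_of_pos (sub_neg.2 (hQmono hs ht h))
          (by linarith [hanti s t h])
      · exact mul_neg_of_pos_of_neg (sub_pos.2 (hQmono ht hs h))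
          (by linarith [hanti t s h])
    linarith
  have hGB : Tendsto G atBot (nhds 0) := by
    simpa using ((hv₂s.tendsto_wronskian_atBot hu₂).div_const κ₂b).sub
      (((hv₁s.tendsto_wronskian_atBot hu₁).div_const κ₁b).const_mul (Q t))
  have hGE : Tendsto G (nhdsWithin A (Iio A)) (nhds 0) := by
    simpa using ((hv₂s.tendsto_wronskian_end hu₂).div_const κ₂b).sub
      (((hv₁s.tendsto_wronskian_end hu₁).div_const κ₁b).const_mul (Q t))
  have p1 : 0 < G t := pos_of_hasDerivAt_neg_of_tendsto_end (fun s hs => hGd s hs.2)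
    (fun s hs => hGneg s hs.2 hs.1.ne') hGE ⟨le_rfl, ht⟩
  have p2 : 0 < -G t := pos_of_hasDerivAt_pos_of_tendsto_atBot (f := fun s => -G s)
    (fun s hs => (hGd s (hs.trans_lt ht)).neg)
    (fun s hs => neg_pos.2 (hGneg s (hs.trans ht) hs.ne)) (by simpa using hGB.neg) le_rfl
  linarith

/-- Inverse of the change of variables `s = log (tan (θ / 2))`. -/
noncomputable def polarAngle (s : ℝ) : ℝ := 2 * arctan (exp s)

theorem sin_polarAngle (s : ℝ) : sin (polarAngle s) = 1 / cosh s := by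
  have h1 : 0 < 1 + exp s ^ 2 := by positivity
  have h2 := exp_pos s
  rw [polarAngle, sin_two_mul, sin_arctan, cos_arctan, cosh_eq, exp_neg]
  have h3 := sq_sqrt h1.le
  have h4 := sqrt_pos.2 h1
  field_simp
  rw [h3]
  ring

theorem cos_polarAngle (s : ℝ) : cos (polarAngle s) = -(sinh s / cosh s) := by
  have h1 : 0 < 1 + exp s ^ 2 := by positivity
  have h2 := exp_pos s
  rw [polarAngle, cos_two_mul, cos_sq_arctan, cosh_eq, sinh_eq, exp_neg]
  field_simp
  ring

theorem hasDerivAt_polarAngle (s : ℝ) : HasDerivAt polarAngle (1 / cosh s) s := by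
  refine (((hasDerivAt_exp s).arctan).const_mul 2).congr_deriv ?_
  have h2 := exp_pos s
  rw [cosh_eq, exp_neg]
  field_simp
  ring

theorem polarAngle_pos (s : ℝ) : 0 < polarAngle s := by
  have := arctan_pos.2 (exp_pos s)
  rw [polarAngle]
  linarith

theorem strictMono_polarAngle : StrictMono polarAngle := fun s t hst => by
  have := arctan_strictMono (exp_strictMono hst)
  simp only [polarAngle]
  linarith

theorem polarAngle_log_tan {r : ℝ} (hr₀ : 0 < r) (hr : r < π) :
    polarAngle (log (tan (r / 2))) = r := by
  rw [polarAngle, exp_log (tan_pos_of_pos_of_lt_pi_div_two (by linarith) (by linarith)),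
    arctan_tan (by linarith) (by linarith)]
  ring

theorem polarAngle_mem_Ioo {r s : ℝ} (hr₀ : 0 < r) (hr : r < π) (hs : s < log (tan (r / 2))) :
    polarAngle s ∈ Ioo 0 r :=
  ⟨polarAngle_pos s, (strictMono_polarAngle hs).trans_eq (polarAngle_log_tan hr₀ hr)⟩

theorem tendsto_polarAngle_atBot : Tendsto polarAngle atBot (nhdsWithin 0 (Ioi 0)) := by
  refine tendsto_nhdsWithin_iff.2 ⟨?_, Eventually.of_forall polarAngle_pos⟩
  change Tendsto (fun s => 2 * arctan (exp s)) atBot (nhds 0)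
  simpa using ((continuous_arctan.tendsto 0).comp tendsto_exp_atBot).const_mul 2

theorem tendsto_polarAngle_end {r : ℝ} (hr₀ : 0 < r) (hr : r < π) :
    Tendsto polarAngle (nhdsWithin (log (tan (r / 2))) (Iio (log (tan (r / 2)))))
      (nhdsWithin r (Iio r)) := by
  refine tendsto_nhdsWithin_iff.2 ⟨?_, ?_⟩
  · have := (hasDerivAt_polarAngle (log (tan (r / 2)))).continuousAt.tendsto
    rw [polarAngle_log_tan hr₀ hr] at this
    exact this.mono_left nhdsWithin_le_nhds
  · filter_upwards [self_mem_nhdsWithin] with s hs using (polarAngle_mem_Ioo hr₀ hr hs).2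

/-- Liouville transform of a radial function `y` in the variable `s = log (tan (θ / 2))`. -/
noncomputable def liouville (h : ℝ) (y : ℝ → ℝ) (s : ℝ) : ℝ := cosh s ^ (-h) * y (polarAngle s)

/-- The derivative of `liouville h y`. -/
noncomputable def liouvilleDeriv (h : ℝ) (y : ℝ → ℝ) (s : ℝ) : ℝ :=
  cosh s ^ (-h) * (-h * (sinh s / cosh s) * y (polarAngle s) + deriv y (polarAngle s) / cosh s)

theorem hasDerivAt_cosh_rpow (h s : ℝ) :
    HasDerivAt (fun s => cosh s ^ (-h)) (cosh s ^ (-h) * (-h * (sinh s / cosh s))) s := by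
  refine ((hasDerivAt_cosh s).rpow_const (Or.inl (cosh_pos s).ne')).congr_deriv ?_
  rw [rpow_sub_one (cosh_pos s).ne']
  ring

theorem hasDerivAt_liouville {h s : ℝ} {y : ℝ → ℝ} (hy : DifferentiableAt ℝ y (polarAngle s)) :
    HasDerivAt (liouville h y) (liouvilleDeriv h y s) s := by
  refine ((hasDerivAt_cosh_rpow h s).mul
    (hy.hasDerivAt.comp s (hasDerivAt_polarAngle s))).congr_deriv ?_
  simp only [liouvilleDeriv, Function.comp]
  ring

theorem hasDerivAt_liouvilleDeriv {h s lam μ m κ N : ℝ} {y : ℝ → ℝ}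
    (hy : DifferentiableAt ℝ y (polarAngle s)) (hy' : DifferentiableAt ℝ (deriv y) (polarAngle s))
    (hN : N = 2 * h + 2) (hm : m ^ 2 = h ^ 2 + μ) (hκ : κ = lam + h * (h + 1))
    (hode : -(deriv (deriv y) (polarAngle s)) - (N - 1) * cot (polarAngle s) *
      deriv y (polarAngle s) + μ * y (polarAngle s) / sin (polarAngle s) ^ 2
        = lam * y (polarAngle s)) :
    HasDerivAt (liouvilleDeriv h y) (sechPotential m κ s * liouville h y s) s := by
  have hc := (cosh_pos s).ne'
  have h1 := ((hasDerivAt_sinh s).div (hasDerivAt_cosh s) hc).const_mul (-h)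
  have h2 := hy.hasDerivAt.comp s (hasDerivAt_polarAngle s)
  have h3 := (hy'.hasDerivAt.comp s (hasDerivAt_polarAngle s)).div (hasDerivAt_cosh s) hc
  refine ((hasDerivAt_cosh_rpow h s).mul ((h1.mul h2).add h3)).congr_deriv ?_
  have e : deriv (deriv y) (polarAngle s) = -(N - 1) * cot (polarAngle s) *
      deriv y (polarAngle s) + μ * y (polarAngle s) / sin (polarAngle s) ^ 2
        - lam * y (polarAngle s) := by linarith
  simp only [Pi.add_apply, Pi.mul_apply, Pi.div_apply, Function.comp, sechPotential, liouville]
  rw [e, cot_eq_cos_div_sin, sin_polarAngle, cos_polarAngle, hm, hκ, hN]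
  have hs : sinh s ^ 2 = cosh s ^ 2 - 1 := by rw [cosh_sq]; ring
  generalize cosh s ^ (-h) = g
  generalize y (polarAngle s) = Y
  generalize deriv y (polarAngle s) = Y'
  field_simp
  ring_nf
  rw [hs]
  ring

theorem cosh_rpow_neg_le_one {h : ℝ} (hh : 0 ≤ h) (s : ℝ) : |cosh s ^ (-h)| ≤ 1 := by
  rw [abs_of_nonneg (rpow_nonneg (cosh_pos s).le _)]
  exact rpow_le_one_of_one_le_of_nonpos (one_le_cosh s) (by linarith)

theorem abs_sechPotential_le (m κ s : ℝ) : |sechPotential m κ s| ≤ m ^ 2 + |κ| := by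
  refine (abs_sub _ _).trans (add_le_add (abs_of_nonneg (sq_nonneg m)).le ?_)
  rw [abs_div, abs_of_nonneg (sq_nonneg (cosh s))]
  exact div_le_self (abs_nonneg κ) (one_le_pow₀ (one_le_cosh s))

theorem bdd_deriv_end_of_tendsto {V w w' : ℝ → ℝ} {S C : ℝ} (hV : ∀ s, |V s| ≤ C)
    (hw' : ∀ s < S, HasDerivAt w' (V s * w s) s)
    (hw : Tendsto w (nhdsWithin S (Iio S)) (nhds 0)) :
    ∃ M, ∀ᶠ s in nhdsWithin S (Iio S), |w' s| ≤ M := by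
  have h1 : ∀ᶠ s in nhdsWithin S (Iio S), |w s| ≤ 1 :=
    (hw.abs.eventually_le_const (by simp))
  obtain ⟨l, hl, hls⟩ := (mem_nhdsLT_iff_exists_Ioo_subset).1 h1
  simp only [mem_Iio] at hl
  obtain ⟨c, hc⟩ := exists_between hl
  have hC : 0 ≤ C := (abs_nonneg _).trans (hV 0)
  refine ⟨|w' c| + C * (S - l), ?_⟩
  filter_upwards [Ioo_mem_nhdsLT hl] with s hs
  have h2 : ‖w' s - w' c‖ ≤ C * ‖s - c‖ := by
    refine Convex.norm_image_sub_le_of_norm_hasDerivWithin_le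
      (fun x hx => (hw' x hx.2).hasDerivWithinAt) (fun x hx => ?_) (convex_Ioo l S) hc hs
    rw [norm_mul, norm_eq_abs, norm_eq_abs]
    have := hls hx
    exact (mul_le_mul (hV x) this (abs_nonneg _) hC).trans_eq (mul_one C)
  have h3 : ‖s - c‖ ≤ S - l := by
    rw [norm_eq_abs, abs_le]
    constructor <;> linarith [hs.1, hs.2, hc.1, hc.2]
  rw [norm_eq_abs] at h2
  have h4 := abs_sub_abs_le_abs_sub (w' s) (w' c)
  have h5 := mul_le_mul_of_nonneg_left h3 hC
  linarith

theorem tendsto_cosh_atBot : Tendsto cosh atBot atTop := by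
  refine tendsto_atTop_mono (f := fun s => exp (-s) / 2) (fun s => ?_)
    ((tendsto_exp_atTop.comp tendsto_neg_atBot_atTop).atTop_div_const two_pos)
  rw [cosh_eq]
  linarith [exp_pos s]

theorem tendsto_deriv_atBot_of_tendsto {m κ S : ℝ} {w w' : ℝ → ℝ} (hm : m ≠ 0)
    (hw : ∀ s < S, HasDerivAt w (w' s) s)
    (hw' : ∀ s < S, HasDerivAt w' (sechPotential m κ s * w s) s)
    (hpos : ∀ s < S, 0 < w s) (h₀ : Tendsto w atBot (nhds 0)) : Tendsto w' atBot (nhds 0) := by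
  have hV : Tendsto (sechPotential m κ) atBot (nhds (m ^ 2)) := by
    have h1 : Tendsto (fun s => cosh s ^ 2) atBot atTop :=
      (tendsto_pow_atTop two_ne_zero).comp tendsto_cosh_atBot
    change Tendsto (fun s => m ^ 2 - κ / cosh s ^ 2) atBot (nhds (m ^ 2))
    simpa using tendsto_const_nhds.sub (h1.const_div_atTop κ)
  have hV0 : ∀ᶠ s in atBot, 0 < sechPotential m κ s :=
    hV.eventually_const_lt (by positivity)
  obtain ⟨c, hc⟩ := eventually_atBot.1 hV0
  set t := min c (S - 1) with ht
  have htS : t < S := (min_le_right _ _).trans_lt (by linarith)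
  have hmono : MonotoneOn w' (Iic t) := by
    refine monotoneOn_of_deriv_nonneg (convex_Iic t)
      (fun x hx => (hw' x (lt_of_le_of_lt hx htS)).continuousAt.continuousWithinAt)
      (fun x hx => ?_) (fun x hx => ?_) <;> rw [interior_Iic] at hx
    · exact (hw' x (lt_trans hx htS)).differentiableAt.differentiableWithinAt
    · rw [(hw' x (lt_trans hx htS)).deriv]
      exact (mul_pos (hc x ((le_of_lt hx).trans (min_le_left _ _)))
        (hpos x (lt_trans hx htS))).le
  have hslope : ∀ x, x + 1 ≤ t → ∃ ξ ∈ Ioo x (x + 1), w' ξ = w (x + 1) - w x := by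
    intro x hx
    obtain ⟨ξ, hξ, h⟩ := exists_hasDerivAt_eq_slope w w' (by linarith : x < x + 1)
      (fun z hz => (hw z (by linarith [hz.2])).continuousAt.continuousWithinAt)
      (fun z hz => hw z (by linarith [hz.2]))
    exact ⟨ξ, hξ, by simpa using h⟩
  have hshift : ∀ d : ℝ, Tendsto (fun s => w (s + d)) atBot (nhds 0) := fun d =>
    h₀.comp (tendsto_atBot_add_const_right _ _ tendsto_id)
  refine tendsto_of_tendsto_of_tendsto_of_le_of_le' (g := fun s => w s - w (s + -1))
    (h := fun s => w (s + 1) - w s) (by simpa using h₀.sub (hshift (-1)))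
    (by simpa using (hshift 1).sub h₀) ?_ ?_
  · filter_upwards [Iic_mem_atBot t] with s hs
    simp only [mem_Iic] at hs
    obtain ⟨ξ, hξ, h⟩ := hslope (s + -1) (by linarith)
    rw [neg_add_cancel_right] at h hξ
    rw [← h]
    exact hmono (hξ.2.le.trans hs) hs hξ.2.le
  · filter_upwards [Iic_mem_atBot (t - 1)] with s hs
    simp only [mem_Iic] at hs
    obtain ⟨ξ, hξ, h⟩ := hslope s (by linarith)
    rw [← h]
    exact hmono (show s ≤ t by linarith) (show ξ ≤ t by linarith [hξ.2]) hξ.1.le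

theorem liouville_isPosSolution {h r lam μ m κ N : ℝ} {y : ℝ → ℝ} (hh : 0 ≤ h) (hr₀ : 0 < r)
    (hr : r < π) (hN : N = 2 * h + 2) (hm : m ^ 2 = h ^ 2 + μ) (hκ : κ = lam + h * (h + 1))
    (hy : ContDiffOn ℝ 2 y (Ioo 0 r)) (hpos : ∀ θ ∈ Ioo 0 r, 0 < y θ)
    (hode : ∀ θ ∈ Ioo 0 r, -(deriv (deriv y) θ) - (N - 1) * cot θ * deriv y θ
      + μ * y θ / sin θ ^ 2 = lam * y θ)
    (hend : Tendsto y (nhdsWithin r (Iio r)) (nhds 0))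
    (hbdd : ∃ M, ∀ᶠ θ in nhdsWithin 0 (Ioi 0), |y θ| ≤ M)
    (hbot : m = 0 ∧ Tendsto (liouvilleDeriv h y) atBot (nhds 0) ∨
      m ≠ 0 ∧ Tendsto (liouville h y) atBot (nhds 0)) :
    IsPosSolution (sechPotential m κ) (log (tan (r / 2))) (liouville h y)
      (liouvilleDeriv h y) := by
  have hd : DifferentiableOn ℝ y (Ioo 0 r) := hy.differentiableOn (by norm_num)
  have hd' : DifferentiableOn ℝ (deriv y) (Ioo 0 r) :=
    (hy.deriv_of_isOpen (m := 1) isOpen_Ioo (by norm_num)).differentiableOn (by norm_num)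
  have hmem := fun s (hs : s < log (tan (r / 2))) => polarAngle_mem_Ioo hr₀ hr hs
  have hw : ∀ s < log (tan (r / 2)), HasDerivAt (liouville h y) (liouvilleDeriv h y s) s :=
    fun s hs => hasDerivAt_liouville (hd.differentiableAt (isOpen_Ioo.mem_nhds (hmem s hs)))
  have hw' : ∀ s < log (tan (r / 2)),
      HasDerivAt (liouvilleDeriv h y) (sechPotential m κ s * liouville h y s) s := fun s hs =>
    hasDerivAt_liouvilleDeriv (hd.differentiableAt (isOpen_Ioo.mem_nhds (hmem s hs)))
      (hd'.differentiableAt (isOpen_Ioo.mem_nhds (hmem s hs))) hN hm hκ (hode _ (hmem s hs))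
  have hp : ∀ s < log (tan (r / 2)), 0 < liouville h y s := fun s hs =>
    mul_pos (rpow_pos_of_pos (cosh_pos s) _) (hpos _ (hmem s hs))
  have hE : Tendsto (liouville h y)
      (nhdsWithin (log (tan (r / 2))) (Iio (log (tan (r / 2))))) (nhds 0) :=
    tendsto_mul_zero_of_eventually_abs_le ⟨1, Eventually.of_forall (cosh_rpow_neg_le_one hh)⟩
      (hend.comp (tendsto_polarAngle_end hr₀ hr))
  refine ⟨hw, hw', hp, ?_, ?_, hE, bdd_deriv_end_of_tendsto (abs_sechPotential_le m κ) hw' hE⟩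
  · obtain ⟨M, hM⟩ := hbdd
    refine ⟨M, ?_⟩
    filter_upwards [tendsto_polarAngle_atBot.eventually hM] with s hs
    rw [liouville, abs_mul]
    exact (mul_le_of_le_one_left (abs_nonneg _) (cosh_rpow_neg_le_one hh s)).trans hs
  · rcases hbot with h | h
    · exact h.2
    · exact tendsto_deriv_atBot_of_tendsto h.1 hw hw' hp h.2

theorem IsFirstRadialEigenfunction.isPosSolution {n : ℕ} (hn : 2 ≤ n) {r lam : ℝ} {y : ℝ → ℝ}
    (hr₀ : 0 < r) (hr : r < π) (hy : IsFirstRadialEigenfunction n r lam y) :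
    IsPosSolution (sechPotential (((n : ℝ) - 2) / 2)
        (lam + ((n : ℝ) - 2) / 2 * (((n : ℝ) - 2) / 2 + 1)))
      (log (tan (r / 2))) (liouville (((n : ℝ) - 2) / 2) y)
      (liouvilleDeriv (((n : ℝ) - 2) / 2) y) := by
  obtain ⟨hC, hpos, hbdd, hder, hode, hend⟩ := hy
  have hn' : (2 : ℝ) ≤ n := by exact_mod_cast hn
  refine liouville_isPosSolution (N := n) (μ := 0) (by linarith) hr₀ hr (by ring) (by ring) rfl hC
    hpos (fun θ hθ => by simpa using hode θ hθ) hend hbdd ?_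
  rcases hn.eq_or_lt with rfl | hlt
  · left
    refine ⟨by norm_num, (hder.comp tendsto_polarAngle_atBot).congr fun s => ?_⟩
    simp [liouvilleDeriv, sin_polarAngle]
    ring
  · right
    have hlt' : (2 : ℝ) < n := by exact_mod_cast hlt
    refine ⟨by linarith, ?_⟩
    obtain ⟨M, hM⟩ := hbdd
    have h1 := tendsto_mul_zero_of_eventually_abs_le
      ⟨M, tendsto_polarAngle_atBot.eventually hM⟩
      ((tendsto_rpow_neg_atTop (by linarith : 0 < ((n : ℝ) - 2) / 2)).comp tendsto_cosh_atBot)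
    exact h1.congr fun s => mul_comm _ _

theorem IsSecondRadialEigenfunction.isPosSolution {n : ℕ} (hn : 2 ≤ n) {r lam : ℝ} {y : ℝ → ℝ}
    (hr₀ : 0 < r) (hr : r < π) (hy : IsSecondRadialEigenfunction n r lam y) :
    IsPosSolution (sechPotential (((n : ℝ) - 2) / 2 + 1)
        (lam + ((n : ℝ) - 2) / 2 * (((n : ℝ) - 2) / 2 + 1)))
      (log (tan (r / 2))) (liouville (((n : ℝ) - 2) / 2) y)
      (liouvilleDeriv (((n : ℝ) - 2) / 2) y) := by
  obtain ⟨hC, hpos, hode, hbot, hend⟩ := hy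
  have hn' : (2 : ℝ) ≤ n := by exact_mod_cast hn
  have hbdd : ∀ᶠ θ in nhdsWithin 0 (Ioi 0), |y θ| ≤ 1 := hbot.abs.eventually_le_const (by simp)
  refine liouville_isPosSolution (N := n) (μ := n - 1) (by linarith) hr₀ hr (by ring) (by ring)
    rfl hC hpos hode hend ⟨1, hbdd⟩ (Or.inr ⟨by linarith, ?_⟩)
  exact tendsto_mul_zero_of_eventually_abs_le
    ⟨1, Eventually.of_forall (cosh_rpow_neg_le_one (by linarith))⟩
    (hbot.comp tendsto_polarAngle_atBot)

/-- The ratio λ₂/λ₁ of the first two Dirichlet eigenvalues of a geodesic ball in `S^n`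
is strictly increasing in the geodesic radius on `(0, π/2]`. -/
theorem eigenvalue_ratio_strictMono (n : ℕ) (hn : 2 ≤ n)
    (a b : ℝ) (ha : 0 < a) (hab : a < b) (hb : b ≤ π / 2)
    (lam1a lam2a lam1b lam2b : ℝ)
    (hlam1a : 0 < lam1a) (hlam2a : 0 < lam2a) (hlam1b : 0 < lam1b) (hlam2b : 0 < lam2b)
    (h1a : ∃ y1, IsFirstRadialEigenfunction n a lam1a y1)
    (h2a : ∃ y2, IsSecondRadialEigenfunction n a lam2a y2)
    (h1b : ∃ y1, IsFirstRadialEigenfunction n b lam1b y1)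
    (h2b : ∃ y2, IsSecondRadialEigenfunction n b lam2b y2) :
    lam2a / lam1a < lam2b / lam1b := by
  obtain ⟨u₁, hu₁⟩ := h1a
  obtain ⟨u₂, hu₂⟩ := h2a
  obtain ⟨v₁, hv₁⟩ := h1b
  obtain ⟨v₂, hv₂⟩ := h2b
  have hb₀ := ha.trans hab
  have hbπ : b < π := by linarith [pi_pos]
  have hu₁ := hu₁.isPosSolution hn ha (hab.trans hbπ)
  have hu₂ := hu₂.isPosSolution hn ha (hab.trans hbπ)
  have hv₁ := hv₁.isPosSolution hn hb₀ hbπ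
  have hv₂ := hv₂.isPosSolution hn hb₀ hbπ
  have hta : 0 < tan (a / 2) := tan_pos_of_pos_of_lt_pi_div_two (by linarith) (by linarith)
  have htab : tan (a / 2) < tan (b / 2) :=
    tan_lt_tan_of_lt_of_lt_pi_div_two (by linarith) (by linarith) (by linarith)
  have htb : tan (b / 2) ≤ 1 := by
    rw [← tan_pi_div_four]
    exact strictMonoOn_tan.monotoneOn ⟨by linarith, by linarith⟩
      ⟨by linarith [pi_pos], by linarith [pi_pos]⟩ (by linarith)
  have hAB := log_lt_log hta htab
  have hB : log (tan (b / 2)) ≤ 0 := log_nonpos (hta.trans htab).le htb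
  have hn' : (2 : ℝ) ≤ n := by exact_mod_cast hn
  have hh : 0 ≤ ((n : ℝ) - 2) / 2 := by linarith
  have hc : 0 ≤ ((n : ℝ) - 2) / 2 * (((n : ℝ) - 2) / 2 + 1) := by positivity
  obtain ⟨hR₂, hR₁⟩ :=
    sechPotential_ratio_lt hh hAB hB (by linarith) (by linarith) hu₁ hu₂ hv₁ hv₂
  have hlt := (sechPotential_lt_and_strictMonoOn_div hh hB hv₁ hv₂).1
  generalize ((n : ℝ) - 2) / 2 * (((n : ℝ) - 2) / 2 + 1) = c at *
  set R := (lam1a + c) / (lam1b + c) with hR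
  have e₁ : lam1a = R * (lam1b + c) - c := by
    rw [hR, div_mul_cancel₀ _ (by linarith)]
    ring
  have e₂ : lam2a < R * (lam2b + c) - c := by
    rw [div_lt_iff₀ (by linarith)] at hR₂
    linarith
  rw [div_lt_div_iff₀ hlam1a hlam1b]
  have e₃ := mul_lt_mul_of_pos_right e₂ hlam1b
  have e₄ : (R - 1) * c * lam1b ≤ (R - 1) * c * lam2b :=
    mul_le_mul_of_nonneg_left (by linarith) (mul_nonneg (by linarith) hc)
  calc lam2a * lam1b < (R * (lam2b + c) - c) * lam1b := e₃
    _ ≤ lam2b * (R * (lam1b + c) - c) := by linarith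
    _ = lam2b * lam1a := by rw [← e₁]
end

section
/- Let n ≥ 2 and 0 < θ1 ≤ π/2. Suppose λ1 > 0 admits a first eigenfunction y1 of the m = 0 radial problem on (0,θ1): y1 twice continuously differentiable and strictly positive on (0,θ1), bounded near 0 with (sin θ)^{n−1} y1'(θ) → 0 as θ → 0⁺, solving −y1'' − (n−1) cot θ · y1' = λ1 y1, with y1(θ) → 0 as θ → θ1⁻. Suppose λ2 > 0 admits a first eigenfunction y2 of the m = 1 radial problem on (0,θ1): y2 twice continuously differentiable and strictly positive on (0,θ1), solving −y2'' − (n−1) cot θ · y2' + (n−1)(sin θ)^{-2} y2 = λ2 y2, with y2(θ) → 0 as θ → 0⁺ and as θ → θ1⁻. Then (λ2 − n)/λ1 ≥ (n+2)/n, with equality if and only if θ1 = π/2. -/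
open Real Set Filter

section Monotonicity

variable {f f' : ℝ → ℝ} {b : ℝ}

/-- A function with nonnegative derivative on `(0,b)` and limit `0` at `0⁺` is nonnegative. -/
theorem nonneg_of_hasDerivAt_nonneg_of_tendsto
    (hf : ∀ x ∈ Ioo 0 b, HasDerivAt f (f' x) x) (hf' : ∀ x ∈ Ioo 0 b, 0 ≤ f' x)
    (h0 : Tendsto f (nhdsWithin 0 (Ioi 0)) (nhds 0)) :
    ∀ x ∈ Ioo 0 b, 0 ≤ f x := by
  intro x hx
  have hmono : MonotoneOn f (Ioo 0 b) := by
    apply monotoneOn_of_deriv_nonneg (convex_Ioo 0 b)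
    · exact fun z hz => (hf z hz).continuousAt.continuousWithinAt
    · rw [interior_Ioo]
      exact fun z hz => (hf z hz).differentiableAt.differentiableWithinAt
    · rw [interior_Ioo]
      intro z hz
      rw [(hf z hz).deriv]
      exact hf' z hz
  refine le_of_tendsto h0 ?_
  filter_upwards [Ioo_mem_nhdsGT hx.1] with z hz
  exact hmono ⟨hz.1, hz.2.trans hx.2⟩ hx hz.2.le

/-- A function with positive derivative on `(0,b)` is strictly increasing there. -/
theorem strictMonoOn_Ioo_of_hasDerivAt_pos
    (hf : ∀ x ∈ Ioo 0 b, HasDerivAt f (f' x) x) (hf' : ∀ x ∈ Ioo 0 b, 0 < f' x) :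
    StrictMonoOn f (Ioo 0 b) := by
  apply strictMonoOn_of_deriv_pos (convex_Ioo 0 b)
  · exact fun z hz => (hf z hz).continuousAt.continuousWithinAt
  · rw [interior_Ioo]
    intro z hz
    rw [(hf z hz).deriv]
    exact hf' z hz

/-- A function with positive derivative on `(0,b)` and limit `0` at `0⁺` is positive. -/
theorem pos_of_hasDerivAt_pos_of_tendsto
    (hf : ∀ x ∈ Ioo 0 b, HasDerivAt f (f' x) x) (hf' : ∀ x ∈ Ioo 0 b, 0 < f' x)
    (h0 : Tendsto f (nhdsWithin 0 (Ioi 0)) (nhds 0)) :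
    ∀ x ∈ Ioo 0 b, 0 < f x := by
  intro x hx
  have hx2 : x / 2 ∈ Ioo 0 b := ⟨by linarith [hx.1], by linarith [hx.1, hx.2]⟩
  exact (nonneg_of_hasDerivAt_nonneg_of_tendsto hf (fun z hz => (hf' z hz).le) h0 _ hx2).trans_lt
    (strictMonoOn_Ioo_of_hasDerivAt_pos hf hf' hx2 hx (by linarith [hx.1]))

/-- A function on `(0,b)` with limit `0` at both ends cannot have positive derivative. -/
theorem not_tendsto_zero_of_hasDerivAt_pos (hb : 0 < b)
    (hf : ∀ x ∈ Ioo 0 b, HasDerivAt f (f' x) x) (hf' : ∀ x ∈ Ioo 0 b, 0 < f' x)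
    (h0 : Tendsto f (nhdsWithin 0 (Ioi 0)) (nhds 0)) :
    ¬ Tendsto f (nhdsWithin b (Iio b)) (nhds 0) := by
  intro h1
  have hc : b / 2 ∈ Ioo 0 b := ⟨by linarith, by linarith⟩
  have hpos := pos_of_hasDerivAt_pos_of_tendsto hf hf' h0 _ hc
  refine absurd (ge_of_tendsto h1 (b := f (b / 2)) ?_) (not_le.mpr hpos)
  filter_upwards [Ioo_mem_nhdsLT hc.2] with z hz
  exact (strictMonoOn_Ioo_of_hasDerivAt_pos hf hf' hc ⟨hc.1.trans hz.1, hz.2⟩ hz.1).le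

/-- A function whose derivative tends to `0` at `b⁻` is bounded near `b⁻`. -/
theorem isBoundedUnder_of_tendsto_hasDerivAt (hb : 0 < b)
    (hf : ∀ x ∈ Ioo 0 b, HasDerivAt f (f' x) x)
    (h1 : Tendsto f' (nhdsWithin b (Iio b)) (nhds 0)) :
    IsBoundedUnder (· ≤ ·) (nhdsWithin b (Iio b)) (fun x => ‖f x‖) := by
  have hev : ∀ᶠ x in nhdsWithin b (Iio b), ‖f' x‖ < 1 := by
    have := h1.norm
    rw [norm_zero] at this
    exact this.eventually (gt_mem_nhds one_pos)
  obtain ⟨l, hl, hsub⟩ := (mem_nhdsLT_iff_exists_mem_Ico_Ioo_subset hb).1 hev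
  have hlb : (l + b) / 2 ∈ Ioo l b := ⟨by linarith [hl.2], by linarith [hl.2]⟩
  refine ⟨‖f ((l + b) / 2)‖ + (b - l), ?_⟩
  rw [eventually_map]
  filter_upwards [Ioo_mem_nhdsLT hl.2] with x hx
  have hmvt := (convex_Ioo l b).norm_image_sub_le_of_norm_hasDerivWithin_le (f := f) (f' := f')
    (C := 1) (fun z hz => (hf z ⟨hl.1.trans_lt hz.1, hz.2⟩).hasDerivWithinAt)
    (fun z hz => (le_of_lt (hsub hz) : ‖f' z‖ ≤ 1)) hlb hx
  have h2 : ‖x - (l + b) / 2‖ ≤ b - l := by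
    rw [Real.norm_eq_abs, abs_le]
    constructor <;> linarith [hx.1, hx.2, hlb.1, hlb.2]
  have h3 := norm_sub_norm_le (f x) (f ((l + b) / 2))
  linarith

end Monotonicity

section Radial

variable {k : ℕ} {b lam lam1 lam2 : ℝ} {y y1 y2 : ℝ → ℝ}

theorem hasDerivAt_of_contDiffOn_two (h : ContDiffOn ℝ 2 y (Ioo 0 b)) {x : ℝ} (hx : x ∈ Ioo 0 b) :
    HasDerivAt y (deriv y x) x ∧ HasDerivAt (deriv y) (deriv (deriv y) x) x := by
  have h1 := h.differentiableOn (by norm_num)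
  have h2 : ContDiffOn ℝ 1 (deriv y) (Ioo 0 b) := h.deriv_of_isOpen isOpen_Ioo (by norm_num)
  have h3 := h2.differentiableOn (by norm_num)
  exact ⟨(h1.differentiableAt (isOpen_Ioo.mem_nhds hx)).hasDerivAt,
    (h3.differentiableAt (isOpen_Ioo.mem_nhds hx)).hasDerivAt⟩

/-- The flux `sin^(n-1) y'` for `n = k + 2`. -/
noncomputable def radialFlux (k : ℕ) (y : ℝ → ℝ) (x : ℝ) : ℝ := sin x ^ (k + 1) * deriv y x

theorem hasDerivAt_radialFlux (h : ContDiffOn ℝ 2 y (Ioo 0 b)) {x : ℝ} (hx : x ∈ Ioo 0 b)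
    (hs : sin x ≠ 0) {q : ℝ}
    (hode : -(deriv (deriv y) x) - ((k : ℝ) + 1) * cot x * deriv y x = q) :
    HasDerivAt (radialFlux k y) (-(sin x ^ (k + 1) * q)) x := by
  have h1 := ((hasDerivAt_sin x).pow (k + 1)).mul (hasDerivAt_of_contDiffOn_two h hx).2
  refine h1.congr_deriv ?_
  rw [← hode, Real.cot_eq_cos_div_sin]
  push_cast
  field_simp
  simp only [Pi.pow_apply]
  ring

theorem hasDerivAt_radialFlux_first (h : IsFirstRadialEigenfunction (k + 2) b lam y) {x : ℝ}
    (hx : x ∈ Ioo 0 b) (hs : sin x ≠ 0) :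
    HasDerivAt (radialFlux k y) (-(sin x ^ (k + 1) * (lam * y x))) x := by
  refine hasDerivAt_radialFlux h.1 hx hs ?_
  rw [← h.2.2.2.2.1 x hx]
  push_cast
  ring

theorem hasDerivAt_radialFlux_second (h : IsSecondRadialEigenfunction (k + 2) b lam y) {x : ℝ}
    (hx : x ∈ Ioo 0 b) (hs : sin x ≠ 0) :
    HasDerivAt (radialFlux k y)
      (sin x ^ (k + 1) * (((k : ℝ) + 1) / sin x ^ 2 - lam) * y x) x := by
  have h1 := hasDerivAt_radialFlux (k := k) (q := lam * y x - ((k : ℝ) + 1) * y x / sin x ^ 2)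
    h.1 hx hs ?_
  · refine h1.congr_deriv ?_
    ring
  · rw [← h.2.2.1 x hx]
    push_cast
    ring

/-- The Wronskian of `y` and `cos`, weighted by `sin^(n-1)`. -/
theorem hasDerivAt_cos_wronskian (h : IsFirstRadialEigenfunction (k + 2) b lam y) {x : ℝ}
    (hx : x ∈ Ioo 0 b) (hs : sin x ≠ 0) :
    HasDerivAt (fun x => radialFlux k y x * cos x + y x * sin x ^ (k + 2))
      (((k : ℝ) + 2 - lam) * (sin x ^ (k + 1) * y x * cos x)) x := by
  have h1 := ((hasDerivAt_radialFlux_first h hx hs).mul (hasDerivAt_cos x)).add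
    ((hasDerivAt_of_contDiffOn_two h.1 hx).1.mul ((hasDerivAt_sin x).pow (k + 2)))
  refine h1.congr_deriv ?_
  simp only [radialFlux, Pi.pow_apply]
  push_cast
  ring

/-- The weighted defect in the comparison of `-y'/y` with `(λ/n) tan`. -/
theorem hasDerivAt_tan_defect (h : IsFirstRadialEigenfunction (k + 2) b lam y) {x : ℝ}
    (hx : x ∈ Ioo 0 b) (hs : sin x ≠ 0) :
    HasDerivAt (fun x => -(radialFlux k y x * cos x) - lam / ((k : ℝ) + 2) * (y x * sin x ^ (k + 2)))
      ((lam / ((k : ℝ) + 2) - 1) * (sin x * -radialFlux k y x)) x := by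
  have h1 := ((hasDerivAt_radialFlux_first h hx hs).mul (hasDerivAt_cos x)).neg.sub
    (((hasDerivAt_of_contDiffOn_two h.1 hx).1.mul
      ((hasDerivAt_sin x).pow (k + 2))).const_mul (lam / ((k : ℝ) + 2)))
  refine h1.congr_deriv ?_
  simp only [radialFlux, Pi.pow_apply]
  push_cast
  have hk : (k : ℝ) + 2 ≠ 0 := by positivity
  field_simp
  ring

/-- The Wronskian of `y2` and `sin * y1`, weighted by `sin^(n-1)`. -/
noncomputable def sinWronskian (k : ℕ) (y1 y2 : ℝ → ℝ) (x : ℝ) : ℝ :=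
  radialFlux k y2 x * (sin x * y1 x)
    - y2 x * (sin x ^ (k + 1) * cos x * y1 x + sin x * radialFlux k y1 x)

theorem hasDerivAt_sinWronskian (h1 : IsFirstRadialEigenfunction (k + 2) b lam1 y1)
    (h2 : IsSecondRadialEigenfunction (k + 2) b lam2 y2) {x : ℝ}
    (hx : x ∈ Ioo 0 b) (hs : sin x ≠ 0) :
    HasDerivAt (sinWronskian k y1 y2)
      (y2 x * ((lam1 + ((k : ℝ) + 2) + 2 * (lam1 / ((k : ℝ) + 2)) - lam2) * (sin x ^ (k + 2) * y1 x)
        + 2 * (-(radialFlux k y1 x * cos x)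
          - lam1 / ((k : ℝ) + 2) * (y1 x * sin x ^ (k + 2))))) x := by
  have hy1 := (hasDerivAt_of_contDiffOn_two h1.1 hx).1
  have hy2 := (hasDerivAt_of_contDiffOn_two h2.1 hx).1
  have h3 := ((hasDerivAt_radialFlux_second h2 hx hs).mul ((hasDerivAt_sin x).mul hy1)).sub
    (hy2.mul (((((hasDerivAt_sin x).pow (k + 1)).mul (hasDerivAt_cos x)).mul hy1).add
      ((hasDerivAt_sin x).mul (hasDerivAt_radialFlux_first h1 hx hs))))
  refine h3.congr_deriv ?_
  simp only [radialFlux, Pi.pow_apply, Pi.mul_apply, Pi.add_apply]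
  push_cast
  have hk : (k : ℝ) + 2 ≠ 0 := by positivity
  have hc : cos x ^ 2 = 1 - sin x ^ 2 := by rw [Real.cos_sq']
  field_simp
  ring_nf
  rw [hc]
  ring

theorem tendsto_sinWronskian {l : Filter ℝ} {a : ℝ} (hl : l ≤ nhds a)
    (hy1 : IsBoundedUnder (· ≤ ·) l (fun x => ‖y1 x‖))
    (hU1 : IsBoundedUnder (· ≤ ·) l (fun x => ‖radialFlux k y1 x‖))
    (hU2 : IsBoundedUnder (· ≤ ·) l (fun x => ‖radialFlux k y2 x‖))
    (hy2 : Tendsto y2 l (nhds 0)) (hw : Tendsto (fun x => sin x * y1 x) l (nhds 0)) :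
    Tendsto (sinWronskian k y1 y2) l (nhds 0) := by
  have e1 := hw.zero_mul_isBoundedUnder_le hU2
  have e2 := hy2.zero_mul_isBoundedUnder_le hy1
  have e3 := hy2.zero_mul_isBoundedUnder_le hU1
  have hs : Tendsto sin l (nhds (sin a)) := (continuous_sin.tendsto a).mono_left hl
  have hc : Tendsto cos l (nhds (cos a)) := (continuous_cos.tendsto a).mono_left hl
  have := (e1.sub (e2.mul ((hs.pow (k + 1)).mul hc))).sub (e3.mul hs)
  simp only [zero_mul, sub_zero] at this
  refine this.congr fun x => ?_
  simp only [sinWronskian]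
  ring

theorem tendsto_neg_zero {l : Filter ℝ} {f : ℝ → ℝ} (h : Tendsto f l (nhds 0)) :
    Tendsto (-f) l (nhds 0) := by
  have := h.neg
  rwa [neg_zero] at this

theorem isBoundedUnder_norm_of_tendsto {l : Filter ℝ} {f : ℝ → ℝ} {c : ℝ}
    (h : Tendsto f l (nhds c)) : IsBoundedUnder (· ≤ ·) l (fun x => ‖f x‖) :=
  h.norm.isBoundedUnder_le

/-- The flux of a positive solution of the `m = 1` equation vanishing at `0` is bounded near `0`. -/
theorem isBoundedUnder_radialFlux_second (hb : 0 < b) (hb' : b ≤ π)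
    (h : IsSecondRadialEigenfunction (k + 2) b lam y) :
    IsBoundedUnder (· ≤ ·) (nhdsWithin 0 (Ioi 0)) (fun x => ‖radialFlux k y x‖) := by
  have hsin : ∀ x ∈ Ioo 0 b, 0 < sin x := fun x hx =>
    sin_pos_of_pos_of_lt_pi hx.1 (hx.2.trans_le hb')
  have hev : ∀ᶠ x in nhdsWithin (0 : ℝ) (Ioi 0), lam * sin x ^ 2 < 1 := by
    have hcont : Tendsto (fun x => lam * sin x ^ 2) (nhds (0 : ℝ)) (nhds (lam * sin 0 ^ 2)) :=
      Continuous.tendsto (by fun_prop) 0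
    refine (hcont.mono_left nhdsWithin_le_nhds).eventually (gt_mem_nhds ?_)
    simp
  obtain ⟨a, ha, hsub⟩ := (mem_nhdsGT_iff_exists_mem_Ioc_Ioo_subset hb).1 hev
  have hab : ∀ x ∈ Ioo 0 a, x ∈ Ioo 0 b := fun x hx => ⟨hx.1, hx.2.trans_le ha.2⟩
  have hmono : StrictMonoOn (radialFlux k y) (Ioo 0 a) := by
    refine strictMonoOn_Ioo_of_hasDerivAt_pos
      (fun x hx => hasDerivAt_radialFlux_second h (hab x hx) (hsin x (hab x hx)).ne') ?_
    intro x hx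
    have hs := hsin x (hab x hx)
    have hlt : lam * sin x ^ 2 < 1 := hsub hx
    have : lam < ((k : ℝ) + 1) / sin x ^ 2 := by
      rw [lt_div_iff₀ (by positivity)]
      have : (0 : ℝ) ≤ k := k.cast_nonneg
      linarith
    have hy := h.2.1 x (hab x hx)
    have := sub_pos.2 this
    positivity
  have hnonneg : ∀ c ∈ Ioo 0 a, 0 ≤ radialFlux k y c := by
    intro c hc
    by_contra! hneg
    have hcb : ∀ x ∈ Ioo 0 c, x ∈ Ioo 0 a := fun x hx => ⟨hx.1, hx.2.trans hc.2⟩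
    have hpos := pos_of_hasDerivAt_pos_of_tendsto (b := c) (f := fun x => -y x)
      (fun x hx => (hasDerivAt_of_contDiffOn_two h.1 (hab x (hcb x hx))).1.neg) ?_
      (by simpa using h.2.2.2.1.neg) (c / 2) ⟨by linarith [hc.1], by linarith [hc.1]⟩
    · have := h.2.1 (c / 2) ⟨by linarith [hc.1], by linarith [hc.1, hc.2, ha.2]⟩
      linarith
    · intro x hx
      have hlt : radialFlux k y x < 0 := (hmono (hcb x hx) hc hx.2).trans hneg
      have hs : 0 < sin x ^ (k + 1) := pow_pos (hsin x (hab x (hcb x hx))) _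
      have := neg_of_mul_neg_right hlt hs.le
      linarith
  have ha2 : a / 2 ∈ Ioo 0 a := ⟨by linarith [ha.1], by linarith [ha.1]⟩
  refine ⟨radialFlux k y (a / 2), ?_⟩
  rw [eventually_map]
  filter_upwards [Ioo_mem_nhdsGT ha2.1] with x hx
  have hxa : x ∈ Ioo 0 a := ⟨hx.1, hx.2.trans ha2.2⟩
  rw [Real.norm_of_nonneg (hnonneg x hxa)]
  exact (hmono hxa ha2 hx.2).le

theorem radialFlux_first_neg (hb : b ≤ π) (hlam : 0 < lam)
    (h : IsFirstRadialEigenfunction (k + 2) b lam y) :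
    ∀ x ∈ Ioo 0 b, radialFlux k y x < 0 := by
  intro x hx
  have hsin : ∀ x ∈ Ioo 0 b, 0 < sin x := fun x hx =>
    sin_pos_of_pos_of_lt_pi hx.1 (hx.2.trans_le hb)
  have := pos_of_hasDerivAt_pos_of_tendsto (f := fun x => -radialFlux k y x)
    (fun x hx => (hasDerivAt_radialFlux_first h hx (hsin x hx).ne').neg)
    (fun x hx => by
      have := h.2.1 x hx
      have := hsin x hx
      rw [neg_neg]
      positivity)
    (by simpa [radialFlux] using h.2.2.2.1.neg) x hx
  linarith

theorem strictAntiOn_radialFlux_first (hb : b ≤ π) (hlam : 0 < lam)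
    (h : IsFirstRadialEigenfunction (k + 2) b lam y) :
    StrictAntiOn (radialFlux k y) (Ioo 0 b) := by
  have hsin : ∀ x ∈ Ioo 0 b, 0 < sin x := fun x hx =>
    sin_pos_of_pos_of_lt_pi hx.1 (hx.2.trans_le hb)
  have := strictMonoOn_Ioo_of_hasDerivAt_pos (f := fun x => -radialFlux k y x)
    (fun x hx => (hasDerivAt_radialFlux_first h hx (hsin x hx).ne').neg)
    (fun x hx => by
      have := h.2.1 x hx
      have := hsin x hx
      rw [neg_neg]
      positivity)
  exact fun x hx z hz hxz => neg_lt_neg_iff.1 (this hx hz hxz)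

theorem tendsto_radialFlux_first (h : IsFirstRadialEigenfunction (k + 2) b lam y) :
    Tendsto (radialFlux k y) (nhdsWithin 0 (Ioi 0)) (nhds 0) :=
  h.2.2.2.1

theorem isBoundedUnder_first (h : IsFirstRadialEigenfunction (k + 2) b lam y) :
    IsBoundedUnder (· ≤ ·) (nhdsWithin 0 (Ioi 0)) (fun x => ‖y x‖) := by
  obtain ⟨M, hM⟩ := h.2.2.1
  exact ⟨M, hM⟩

theorem tendsto_sin_pow_zero (m : ℕ) :
    Tendsto (fun x => sin x ^ (m + 1)) (nhdsWithin 0 (Ioi 0)) (nhds 0) := by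
  have : Tendsto (fun x => sin x ^ (m + 1)) (nhds (0 : ℝ)) (nhds (sin 0 ^ (m + 1))) :=
    Continuous.tendsto (by fun_prop) 0
  simpa using this.mono_left nhdsWithin_le_nhds

theorem tendsto_mul_sin_pow_first (h : IsFirstRadialEigenfunction (k + 2) b lam y) (m : ℕ) :
    Tendsto (fun x => y x * sin x ^ (m + 1)) (nhdsWithin 0 (Ioi 0)) (nhds 0) := by
  simpa [mul_comm] using (tendsto_sin_pow_zero m).zero_mul_isBoundedUnder_le
    (isBoundedUnder_first h)

theorem tendsto_radialFlux_mul_cos_first (h : IsFirstRadialEigenfunction (k + 2) b lam y) :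
    Tendsto (fun x => radialFlux k y x * cos x) (nhdsWithin 0 (Ioi 0)) (nhds 0) := by
  simpa using (tendsto_radialFlux_first h).mul
    ((continuous_cos.tendsto 0).mono_left nhdsWithin_le_nhds)

theorem isBoundedUnder_radialFlux_first_right (hb : 0 < b) (hb' : b ≤ π)
    (h : IsFirstRadialEigenfunction (k + 2) b lam y) :
    IsBoundedUnder (· ≤ ·) (nhdsWithin b (Iio b)) (fun x => ‖radialFlux k y x‖) := by
  refine isBoundedUnder_of_tendsto_hasDerivAt hb (fun x hx => hasDerivAt_radialFlux_first h hx
    (sin_pos_of_pos_of_lt_pi hx.1 (hx.2.trans_le hb')).ne') ?_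
  have hs : Tendsto sin (nhdsWithin b (Iio b)) (nhds (sin b)) :=
    (continuous_sin.tendsto b).mono_left nhdsWithin_le_nhds
  simpa using ((hs.pow (k + 1)).mul (h.2.2.2.2.2.const_mul lam)).neg

theorem isBoundedUnder_radialFlux_second_right (hb : 0 < b) (hb' : b < π)
    (h : IsSecondRadialEigenfunction (k + 2) b lam y) :
    IsBoundedUnder (· ≤ ·) (nhdsWithin b (Iio b)) (fun x => ‖radialFlux k y x‖) := by
  refine isBoundedUnder_of_tendsto_hasDerivAt hb (fun x hx => hasDerivAt_radialFlux_second h hx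
    (sin_pos_of_pos_of_lt_pi hx.1 (hx.2.trans hb')).ne') ?_
  have hs : Tendsto sin (nhdsWithin b (Iio b)) (nhds (sin b)) :=
    (continuous_sin.tendsto b).mono_left nhdsWithin_le_nhds
  have hne : sin b ^ 2 ≠ 0 := pow_ne_zero _ (sin_pos_of_pos_of_lt_pi hb hb').ne'
  have hq : Tendsto (fun x => ((k : ℝ) + 1) / sin x ^ 2 - lam) (nhdsWithin b (Iio b))
      (nhds (((k : ℝ) + 1) / sin b ^ 2 - lam)) :=
    (tendsto_const_nhds.div (hs.pow 2) hne).sub_const lam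
  simpa using ((hs.pow (k + 1)).mul hq).mul h.2.2.2.2

theorem tendsto_sinWronskian_zero (hb : 0 < b) (hb' : b ≤ π)
    (h1 : IsFirstRadialEigenfunction (k + 2) b lam1 y1)
    (h2 : IsSecondRadialEigenfunction (k + 2) b lam2 y2) :
    Tendsto (sinWronskian k y1 y2) (nhdsWithin 0 (Ioi 0)) (nhds 0) :=
  tendsto_sinWronskian nhdsWithin_le_nhds (isBoundedUnder_first h1)
    (isBoundedUnder_norm_of_tendsto (tendsto_radialFlux_first h1))
    (isBoundedUnder_radialFlux_second hb hb' h2) h2.2.2.2.1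
    (by simpa [mul_comm] using tendsto_mul_sin_pow_first h1 0)

theorem tendsto_sinWronskian_right (hb : 0 < b) (hb' : b < π)
    (h1 : IsFirstRadialEigenfunction (k + 2) b lam1 y1)
    (h2 : IsSecondRadialEigenfunction (k + 2) b lam2 y2) :
    Tendsto (sinWronskian k y1 y2) (nhdsWithin b (Iio b)) (nhds 0) :=
  tendsto_sinWronskian nhdsWithin_le_nhds (isBoundedUnder_norm_of_tendsto h1.2.2.2.2.2)
    (isBoundedUnder_radialFlux_first_right hb hb'.le h1)
    (isBoundedUnder_radialFlux_second_right hb hb' h2) h2.2.2.2.2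
    (by simpa using ((continuous_sin.tendsto b).mono_left nhdsWithin_le_nhds).mul h1.2.2.2.2.2)

theorem tendsto_cos_wronskian_zero (h : IsFirstRadialEigenfunction (k + 2) b lam y) :
    Tendsto (fun x => radialFlux k y x * cos x + y x * sin x ^ (k + 2))
      (nhdsWithin 0 (Ioi 0)) (nhds 0) := by
  simpa using (tendsto_radialFlux_mul_cos_first h).add (tendsto_mul_sin_pow_first h (k + 1))

theorem tendsto_tan_defect_zero (h : IsFirstRadialEigenfunction (k + 2) b lam y) (c : ℝ) :
    Tendsto (fun x => -(radialFlux k y x * cos x) - c * (y x * sin x ^ (k + 2)))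
      (nhdsWithin 0 (Ioi 0)) (nhds 0) := by
  simpa using (tendsto_radialFlux_mul_cos_first h).neg.sub
    ((tendsto_mul_sin_pow_first h (k + 1)).const_mul c)

/-- Balls smaller than the hemisphere have `λ₁ > n`. -/
theorem lt_first_eigenvalue (hb : 0 < b) (hb' : b < π / 2) (hlam : 0 < lam)
    (h : IsFirstRadialEigenfunction (k + 2) b lam y) : (k : ℝ) + 2 < lam := by
  by_contra! hle
  have hpi := Real.pi_pos
  have hnonneg := nonneg_of_hasDerivAt_nonneg_of_tendsto
    (fun x hx => hasDerivAt_cos_wronskian h hx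
      (sin_pos_of_pos_of_lt_pi hx.1 (by linarith [hx.2])).ne')
    (fun x hx => by
      have hs : 0 < sin x := sin_pos_of_pos_of_lt_pi hx.1 (by linarith [hx.2])
      have hc : 0 < cos x := cos_pos_of_mem_Ioo ⟨by linarith [hx.1], by linarith [hx.2]⟩
      have hy := h.2.1 x hx
      have := sub_nonneg.2 hle
      positivity)
    (tendsto_cos_wronskian_zero h)
  have hmem : b / 2 ∈ Ioo 0 b := ⟨by linarith, by linarith⟩
  have hneg := radialFlux_first_neg (by linarith) hlam h _ hmem
  have hs : Tendsto sin (nhdsWithin b (Iio b)) (nhds (sin b)) :=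
    (continuous_sin.tendsto b).mono_left nhdsWithin_le_nhds
  have hc : Tendsto cos (nhdsWithin b (Iio b)) (nhds (cos b)) :=
    (continuous_cos.tendsto b).mono_left nhdsWithin_le_nhds
  have hlim := (hc.const_mul (radialFlux k y (b / 2))).add (h.2.2.2.2.2.mul (hs.pow (k + 2)))
  have hge := ge_of_tendsto hlim (b := 0) ?_
  · have hcb : 0 < cos b := cos_pos_of_mem_Ioo ⟨by linarith, hb'⟩
    have := mul_neg_of_neg_of_pos hneg hcb
    linarith
  · filter_upwards [Ioo_mem_nhdsLT hmem.2] with x hx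
    have hxb : x ∈ Ioo 0 b := ⟨hmem.1.trans hx.1, hx.2⟩
    have hcx : 0 < cos x := cos_pos_of_mem_Ioo ⟨by linarith [hxb.1], by linarith [hx.2]⟩
    have hanti := strictAntiOn_radialFlux_first (by linarith) hlam h hmem hxb hx.1
    have := mul_lt_mul_of_pos_right hanti hcx
    have := hnonneg x hxb
    linarith

/-- The hemisphere has `λ₁ = n`. -/
theorem first_eigenvalue_hemisphere (h : IsFirstRadialEigenfunction (k + 2) (π / 2) lam y) :
    lam = (k : ℝ) + 2 := by
  have hpi := Real.pi_pos
  have hb : 0 < π / 2 := by linarith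
  have hs : Tendsto sin (nhdsWithin (π / 2) (Iio (π / 2))) (nhds (sin (π / 2))) :=
    (continuous_sin.tendsto _).mono_left nhdsWithin_le_nhds
  have hc : Tendsto cos (nhdsWithin (π / 2) (Iio (π / 2))) (nhds 0) := by
    simpa using (continuous_cos.tendsto (π / 2)).mono_left nhdsWithin_le_nhds
  have hsin : ∀ x ∈ Ioo 0 (π / 2), 0 < sin x := fun x hx =>
    sin_pos_of_pos_of_lt_pi hx.1 (by linarith [hx.2])
  have hpos : ∀ x ∈ Ioo 0 (π / 2), 0 < sin x ^ (k + 1) * y x * cos x := fun x hx => by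
    have := hsin x hx
    have hc : 0 < cos x := cos_pos_of_mem_Ioo ⟨by linarith [hx.1], hx.2⟩
    have hy := h.2.1 x hx
    positivity
  have hright : Tendsto (fun x => radialFlux k y x * cos x + y x * sin x ^ (k + 2))
      (nhdsWithin (π / 2) (Iio (π / 2))) (nhds 0) := by
    have e1 := hc.zero_mul_isBoundedUnder_le
      (isBoundedUnder_radialFlux_first_right hb (by linarith) h)
    simpa [mul_comm] using e1.add (h.2.2.2.2.2.mul (hs.pow (k + 2)))
  have hleft := tendsto_cos_wronskian_zero h
  have hder := fun x hx => hasDerivAt_cos_wronskian h (x := x) hx (hsin x hx).ne'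
  rcases lt_trichotomy lam ((k : ℝ) + 2) with hlt | heq | hgt
  · exact absurd hright (not_tendsto_zero_of_hasDerivAt_pos hb hder
      (fun x hx => mul_pos (by linarith) (hpos x hx)) hleft)
  · exact heq
  · exact absurd (tendsto_neg_zero hright) (not_tendsto_zero_of_hasDerivAt_pos hb
      (fun x hx => (hder x hx).neg)
      (fun x hx => by nlinarith [mul_pos (sub_pos.2 hgt) (hpos x hx)])
      (tendsto_neg_zero hleft))

theorem lt_second_eigenvalue (hb : 0 < b) (hb' : b < π / 2) (hlam : 0 < lam1)
    (h1 : IsFirstRadialEigenfunction (k + 2) b lam1 y1)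
    (h2 : IsSecondRadialEigenfunction (k + 2) b lam2 y2) :
    lam1 + ((k : ℝ) + 2) + 2 * (lam1 / ((k : ℝ) + 2)) < lam2 := by
  by_contra! hle
  have hpi := Real.pi_pos
  have hsin : ∀ x ∈ Ioo 0 b, 0 < sin x := fun x hx =>
    sin_pos_of_pos_of_lt_pi hx.1 (by linarith [hx.2])
  have hlt : 0 < lam1 / ((k : ℝ) + 2) - 1 := by
    rw [sub_pos, one_lt_div (by positivity)]
    exact lt_first_eigenvalue hb hb' hlam h1
  have hdef := pos_of_hasDerivAt_pos_of_tendsto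
    (fun x hx => hasDerivAt_tan_defect h1 hx (hsin x hx).ne')
    (fun x hx => mul_pos hlt (mul_pos (hsin x hx)
      (neg_pos.2 (radialFlux_first_neg (by linarith) hlam h1 x hx))))
    (tendsto_tan_defect_zero h1 _)
  refine not_tendsto_zero_of_hasDerivAt_pos hb
    (fun x hx => hasDerivAt_sinWronskian h1 h2 hx (hsin x hx).ne') (fun x hx => ?_)
    (tendsto_sinWronskian_zero hb (by linarith) h1 h2)
    (tendsto_sinWronskian_right hb (by linarith) h1 h2)
  have hd := hdef x hx
  have hy1 := h1.2.1 x hx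
  have hs := hsin x hx
  refine mul_pos (h2.2.1 x hx) (add_pos_of_nonneg_of_pos ?_ (by linarith))
  exact mul_nonneg (sub_nonneg.2 hle) (by positivity)

theorem second_eigenvalue_hemisphere
    (h1 : IsFirstRadialEigenfunction (k + 2) (π / 2) lam1 y1)
    (h2 : IsSecondRadialEigenfunction (k + 2) (π / 2) lam2 y2) :
    lam2 = 2 * ((k : ℝ) + 2) + 2 := by
  have hpi := Real.pi_pos
  have hb : 0 < π / 2 := by linarith
  have hk : (k : ℝ) + 2 ≠ 0 := by positivity
  obtain rfl := first_eigenvalue_hemisphere h1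
  have hsin : ∀ x ∈ Ioo 0 (π / 2), 0 < sin x := fun x hx =>
    sin_pos_of_pos_of_lt_pi hx.1 (by linarith [hx.2])
  have hder := fun x hx => hasDerivAt_tan_defect h1 (x := x) hx (hsin x hx).ne'
  have hleft := tendsto_tan_defect_zero h1 (((k : ℝ) + 2) / ((k : ℝ) + 2))
  have hge := nonneg_of_hasDerivAt_nonneg_of_tendsto hder (fun x hx => by simp [div_self hk]) hleft
  have hle := nonneg_of_hasDerivAt_nonneg_of_tendsto (fun x hx => (hder x hx).neg)
    (fun x hx => by simp [div_self hk]) (tendsto_neg_zero hleft)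
  have hV : ∀ x ∈ Ioo 0 (π / 2), HasDerivAt (sinWronskian k y1 y2)
      ((2 * ((k : ℝ) + 2) + 2 - lam2) * (y2 x * (sin x ^ (k + 2) * y1 x))) x := fun x hx => by
    refine (hasDerivAt_sinWronskian h1 h2 hx (hsin x hx).ne').congr_deriv ?_
    have hz : -(radialFlux k y1 x * cos x) - ((k : ℝ) + 2) / ((k : ℝ) + 2) *
        (y1 x * sin x ^ (k + 2)) = 0 := le_antisymm (neg_nonneg.1 (hle x hx)) (hge x hx)
    rw [hz, div_self hk]
    ring
  have hpos : ∀ x ∈ Ioo 0 (π / 2), 0 < y2 x * (sin x ^ (k + 2) * y1 x) := fun x hx =>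
    mul_pos (h2.2.1 x hx) (mul_pos (pow_pos (hsin x hx) _) (h1.2.1 x hx))
  have hV0 := tendsto_sinWronskian_zero hb (by linarith) h1 h2
  have hV1 := tendsto_sinWronskian_right hb (by linarith) h1 h2
  rcases lt_trichotomy lam2 (2 * ((k : ℝ) + 2) + 2) with hlt | heq | hgt
  · exact absurd hV1 (not_tendsto_zero_of_hasDerivAt_pos hb hV
      (fun x hx => mul_pos (by linarith) (hpos x hx)) hV0)
  · exact heq
  · exact absurd (tendsto_neg_zero hV1) (not_tendsto_zero_of_hasDerivAt_pos hb
      (fun x hx => (hV x hx).neg)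
      (fun x hx => by nlinarith [mul_pos (sub_pos.2 hgt) (hpos x hx)])
      (tendsto_neg_zero hV0))

end Radial

/-- For a geodesic ball of radius `θ1 ≤ π/2` in `S^n` with first two Dirichlet
eigenvalues `λ₁, λ₂`, one has `(λ₂ - n)/λ₁ ≥ (n+2)/n`, with equality iff
`θ1 = π/2` (the hemisphere). -/
theorem eigenvalue_gap_ratio_ge (n : ℕ) (hn : 2 ≤ n)
    (θ1 : ℝ) (hθ1 : 0 < θ1) (hθ1' : θ1 ≤ π / 2)
    (lam1 lam2 : ℝ) (hlam1 : 0 < lam1) (hlam2 : 0 < lam2)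
    (y1 y2 : ℝ → ℝ)
    (h1 : IsFirstRadialEigenfunction n θ1 lam1 y1)
    (h2 : IsSecondRadialEigenfunction n θ1 lam2 y2) :
    ((n : ℝ) + 2) / n ≤ (lam2 - n) / lam1 ∧
      ((lam2 - (n : ℝ)) / lam1 = ((n : ℝ) + 2) / n ↔ θ1 = π / 2) := by
  obtain ⟨k, rfl⟩ : ∃ k, n = k + 2 := ⟨n - 2, by omega⟩
  have hk : (0 : ℝ) < (k : ℝ) + 2 := by positivity
  push_cast
  rcases hθ1'.lt_or_eq with hlt | rfl
  · have h := lt_second_eigenvalue hθ1 hlt hlam1 h1 h2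
    have hgap : ((k : ℝ) + 2 + 2) / (k + 2) < (lam2 - (k + 2)) / lam1 := by
      rw [lt_div_iff₀ hlam1]
      have : ((k : ℝ) + 2 + 2) / (k + 2) * lam1 = lam1 + 2 * (lam1 / ((k : ℝ) + 2)) := by
        field_simp
      linarith
    exact ⟨hgap.le, fun he => absurd he hgap.ne', fun he => absurd he hlt.ne⟩
  · have hgap : (lam2 - ((k : ℝ) + 2)) / lam1 = ((k : ℝ) + 2 + 2) / (k + 2) := by
      rw [second_eigenvalue_hemisphere h1 h2, first_eigenvalue_hemisphere h1]
      ring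
    exact ⟨hgap.ge, fun _ => rfl, fun _ => hgap⟩
end

section
/- Gap bound: let n ≥ 2 and 0 < θ1 ≤ π/2. With λ1 > 0 and y1 a first eigenfunction of the m = 0 radial problem on (0,θ1) (y1 strictly positive on (0,θ1), bounded near 0 with (sin θ)^{n−1} y1'(θ) → 0 as θ → 0⁺, solving −y1'' − (n−1) cot θ · y1' = λ1 y1, and y1 → 0 at θ1), and λ2 > 0 with y2 a first eigenfunction of the m = 1 radial problem on (0,θ1) (y2 strictly positive on (0,θ1), solving −y2'' − (n−1) cot θ · y2' + (n−1)(sin θ)^{-2} y2 = λ2 y2, with y2 → 0 at 0 and at θ1), one has λ2 − λ1 > (n−1)/sin²θ1. -/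
open Real Set Filter

/-- Sturm–Liouville form of the radial equation `y'' + (n-1) cot θ · y' = q y`. -/
theorem hasDerivAt_sin_pow_mul_deriv {n : ℕ} (hn : 2 ≤ n) {b x : ℝ} {y : ℝ → ℝ} {q : ℝ}
    (hy : ContDiffOn ℝ 2 y (Ioo 0 b)) (hx : x ∈ Ioo 0 b) (hs : 0 < Real.sin x)
    (hode : deriv (deriv y) x + ((n : ℝ) - 1) * Real.cot x * deriv y x = q * y x) :
    HasDerivAt (fun t => Real.sin t ^ (n - 1) * deriv y t)
      (Real.sin x ^ (n - 1) * (q * y x)) x := by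
  obtain ⟨m, rfl⟩ := Nat.exists_eq_add_of_le' hn
  have hC1 : ContDiffOn ℝ 1 (deriv y) (Ioo 0 b) :=
    ((contDiffOn_succ_iff_deriv_of_isOpen (n := 1) isOpen_Ioo).1
      (by simpa [one_add_one_eq_two] using hy)).2.2
  have hd : HasDerivAt (deriv y) (deriv (deriv y) x) x :=
    ((hC1.differentiableOn one_ne_zero).differentiableAt (Ioo_mem_nhds hx.1 hx.2)).hasDerivAt
  refine (((Real.hasDerivAt_sin x).pow (m + 2 - 1)).mul hd).congr_deriv ?_
  have e : m + 2 - 1 = m + 1 := rfl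
  rw [← hode, e, Real.cot_eq_cos_div_sin]
  simp only [Pi.pow_apply, Nat.add_sub_cancel]
  push_cast
  field_simp
  ring

/-- A solution of the radial equation vanishing at the right endpoint has bounded
flux `sin^(n-1) · y'` there. -/
theorem isBoundedUnder_sin_pow_mul_deriv {n : ℕ} {b : ℝ} (hb : 0 < b) {y q : ℝ → ℝ}
    (hq : ContinuousAt q b)
    (hD : ∀ x ∈ Ioo 0 b, HasDerivAt (fun t => Real.sin t ^ (n - 1) * deriv y t)
      (Real.sin x ^ (n - 1) * (q x * y x)) x)
    (hy : Tendsto y (nhdsWithin b (Iio b)) (nhds 0)) :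
    IsBoundedUnder (· ≤ ·) (nhdsWithin b (Iio b))
      (norm ∘ fun t => Real.sin t ^ (n - 1) * deriv y t) := by
  have hlim : Tendsto (fun x => Real.sin x ^ (n - 1) * (q x * y x))
      (nhdsWithin b (Iio b)) (nhds 0) := by
    have hp : Tendsto (fun x => Real.sin x ^ (n - 1)) (nhdsWithin b (Iio b))
        (nhds (Real.sin b ^ (n - 1))) :=
      ((Real.continuous_sin.pow (n - 1)).tendsto b).mono_left nhdsWithin_le_nhds
    simpa using hp.mul ((hq.tendsto.mono_left nhdsWithin_le_nhds).mul hy)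
  have hev : ∀ᶠ x in nhdsWithin b (Iio b),
      ‖Real.sin x ^ (n - 1) * (q x * y x)‖ ≤ 1 ∧ 0 < x := by
    refine (hlim.norm.eventually_le_const (by simp)).and ?_
    exact nhdsWithin_le_nhds (lt_mem_nhds hb)
  obtain ⟨c, hc, hcs⟩ := (mem_nhdsLT_iff_exists_Ioo_subset).1 hev
  obtain ⟨x₀, hx₀⟩ := nonempty_Ioo.2 (mem_Iio.1 hc)
  refine ⟨‖Real.sin x₀ ^ (n - 1) * deriv y x₀‖ + (b - c), ?_⟩
  rw [eventually_map]
  filter_upwards [Ioo_mem_nhdsLT hc] with x hx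
  have h := (convex_Ioo c b).norm_image_sub_le_of_norm_hasDerivWithin_le
    (fun z hz => (hD z ⟨(hcs hz).2, hz.2⟩).hasDerivWithinAt) (fun z hz => (hcs hz).1) hx₀ hx
  have h2 : ‖x - x₀‖ ≤ b - c := by
    rw [Real.norm_eq_abs, abs_le]
    constructor <;> linarith [hx.1, hx.2, hx₀.1, hx₀.2]
  have h3 := norm_sub_norm_le (Real.sin x ^ (n - 1) * deriv y x)
    (Real.sin x₀ ^ (n - 1) * deriv y x₀)
  simp only [Function.comp_apply]
  linarith

/-- A positive function tending to `0` at `0⁺` cannot have negative derivative near `0`. -/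
theorem not_eventually_deriv_neg_of_pos {b : ℝ} (hb : 0 < b) {y : ℝ → ℝ}
    (hpos : ∀ x ∈ Ioo 0 b, 0 < y x) (hdiff : DifferentiableOn ℝ y (Ioo 0 b))
    (hlim : Tendsto y (nhdsWithin 0 (Ioi 0)) (nhds 0)) :
    ¬ ∀ᶠ x in nhdsWithin 0 (Ioi 0), deriv y x < 0 := by
  intro hneg
  obtain ⟨c, hc, hcs⟩ := (mem_nhdsGT_iff_exists_Ioo_subset).1
    (hneg.and (Ioo_mem_nhdsGT hb))
  have hanti : StrictAntiOn y (Ioo 0 c) := by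
    refine strictAntiOn_of_deriv_neg (convex_Ioo 0 c)
      (hdiff.continuousOn.mono fun x hx => (hcs hx).2) ?_
    rw [interior_Ioo]
    exact fun x hx => (hcs hx).1
  obtain ⟨x, hx⟩ := nonempty_Ioo.2 (mem_Ioi.1 hc)
  have : y x ≤ 0 := by
    refine ge_of_tendsto hlim ?_
    filter_upwards [Ioo_mem_nhdsGT hx.1] with t ht
    exact (hanti ⟨ht.1, ht.2.trans hx.2⟩ hx ht.2).le
  exact absurd (hpos x (hcs hx).2) this.not_gt

/-- Gap bound: for a geodesic ball of radius `0 < θ1 ≤ π/2` in `S^n` with first two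
Dirichlet eigenvalues `λ₁, λ₂`, one has `λ₂ - λ₁ > (n-1)/sin²θ1`. -/
theorem eigenvalue_gap_gt (n : ℕ) (hn : 2 ≤ n)
    (θ1 : ℝ) (hθ1 : 0 < θ1) (hθ1' : θ1 ≤ π / 2)
    (lam1 lam2 : ℝ) (hlam1 : 0 < lam1) (hlam2 : 0 < lam2)
    (y1 y2 : ℝ → ℝ)
    (h1 : IsFirstRadialEigenfunction n θ1 lam1 y1)
    (h2 : IsSecondRadialEigenfunction n θ1 lam2 y2) :
    ((n : ℝ) - 1) / Real.sin θ1 ^ 2 < lam2 - lam1 := by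
  obtain ⟨hC1, hpos1, -, hflux1, hode1, hlim1⟩ := h1
  obtain ⟨hC2, hpos2, hode2, hzero2, hlim2⟩ := h2
  by_contra! hle
  have hsin : ∀ x ∈ Ioo 0 θ1, 0 < Real.sin x := fun x hx =>
    Real.sin_pos_of_pos_of_lt_pi hx.1 (by linarith [hx.2, Real.pi_pos])
  have hsb : 0 < Real.sin θ1 :=
    Real.sin_pos_of_pos_of_lt_pi hθ1 (by linarith [Real.pi_pos])
  have hn1 : (0 : ℝ) < (n : ℝ) - 1 := by
    have : (2 : ℝ) ≤ n := by exact_mod_cast hn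
    linarith
  have hD1 : ∀ x ∈ Ioo 0 θ1, HasDerivAt (fun t => Real.sin t ^ (n - 1) * deriv y1 t)
      (Real.sin x ^ (n - 1) * (-lam1 * y1 x)) x := fun x hx =>
    hasDerivAt_sin_pow_mul_deriv hn hC1 hx (hsin x hx) (by linarith [hode1 x hx])
  have hD2 : ∀ x ∈ Ioo 0 θ1, HasDerivAt (fun t => Real.sin t ^ (n - 1) * deriv y2 t)
      (Real.sin x ^ (n - 1) * ((((n : ℝ) - 1) / Real.sin x ^ 2 - lam2) * y2 x)) x :=
    fun x hx => hasDerivAt_sin_pow_mul_deriv hn hC2 hx (hsin x hx) (by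
      rw [sub_mul _ lam2, div_mul_eq_mul_div]
      linarith [hode2 x hx])
  have hdiff1 := hC1.differentiableOn two_ne_zero
  have hdiff2 := hC2.differentiableOn two_ne_zero
  have hB1 := isBoundedUnder_sin_pow_mul_deriv (q := fun _ => -lam1) hθ1
    continuousAt_const hD1 hlim1
  have hB2 := isBoundedUnder_sin_pow_mul_deriv
    (q := fun x => ((n : ℝ) - 1) / Real.sin x ^ 2 - lam2) hθ1
    ((continuousAt_const.div (Real.continuous_sin.continuousAt.pow 2)
      (pow_ne_zero 2 hsb.ne')).sub continuousAt_const) hD2 hlim2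
  set W : ℝ → ℝ := fun t => (Real.sin t ^ (n - 1) * deriv y1 t) * y2 t
    - y1 t * (Real.sin t ^ (n - 1) * deriv y2 t) with hW
  have hDW : ∀ x ∈ Ioo 0 θ1, HasDerivAt W (Real.sin x ^ (n - 1) * (y1 x * y2 x) *
      (lam2 - lam1 - ((n : ℝ) - 1) / Real.sin x ^ 2)) x := fun x hx => by
    have e1 := (hdiff1.differentiableAt (Ioo_mem_nhds hx.1 hx.2)).hasDerivAt
    have e2 := (hdiff2.differentiableAt (Ioo_mem_nhds hx.1 hx.2)).hasDerivAt
    refine (((hD1 x hx).mul e2).sub (e1.mul (hD2 x hx))).congr_deriv ?_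
    ring
  have hanti : StrictAntiOn W (Ioo 0 θ1) := by
    refine strictAntiOn_of_deriv_neg (convex_Ioo 0 θ1)
      (fun x hx => (hDW x hx).continuousAt.continuousWithinAt) fun x hx => ?_
    rw [interior_Ioo] at hx
    rw [(hDW x hx).deriv]
    have hs := hsin x hx
    have hlt : Real.sin x < Real.sin θ1 :=
      Real.sin_lt_sin_of_lt_of_le_pi_div_two (by linarith [hx.1, Real.pi_pos]) hθ1' hx.2
    have hq : ((n : ℝ) - 1) / Real.sin θ1 ^ 2 < ((n : ℝ) - 1) / Real.sin x ^ 2 := by gcongr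
    exact mul_neg_of_pos_of_neg
      (mul_pos (pow_pos hs _) (mul_pos (hpos1 x hx) (hpos2 x hx))) (by linarith)
  have hWlim : Tendsto W (nhdsWithin θ1 (Iio θ1)) (nhds 0) := by
    simpa using (isBoundedUnder_le_mul_tendsto_zero hB1 hlim2).sub (hlim1.zero_mul_isBoundedUnder_le hB2)
  have hWpos : ∀ x ∈ Ioo 0 θ1, 0 ≤ W x := fun x hx => by
    refine le_of_tendsto hWlim ?_
    filter_upwards [Ioo_mem_nhdsLT hx.2] with t ht
    exact (hanti hx ⟨hx.1.trans ht.1, ht.2⟩ ht.1).le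
  obtain ⟨a, ha⟩ := nonempty_Ioo.2 hθ1
  obtain ⟨d, hd⟩ := nonempty_Ioo.2 ha.2
  have hWa : 0 < W a :=
    (hWpos d ⟨ha.1.trans hd.1, hd.2⟩).trans_lt (hanti ha ⟨ha.1.trans hd.1, hd.2⟩ hd.1)
  have hterm : Tendsto (fun t => (Real.sin t ^ (n - 1) * deriv y1 t) * y2 t)
      (nhdsWithin 0 (Ioi 0)) (nhds 0) := by
    simpa using hflux1.mul hzero2
  refine not_eventually_deriv_neg_of_pos hθ1 hpos2 hdiff2 hzero2 ?_
  filter_upwards [hterm.eventually_lt_const hWa, Ioo_mem_nhdsGT ha.1] with t ht hta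
  have htb : t ∈ Ioo 0 θ1 := ⟨hta.1, hta.2.trans ha.2⟩
  have hWt : W a < W t := hanti htb ha hta.2
  by_contra! hge
  have : 0 ≤ y1 t * (Real.sin t ^ (n - 1) * deriv y2 t) :=
    mul_nonneg (hpos1 t htb).le (mul_nonneg (pow_nonneg (hsin t htb).le _) hge)
  simp only [hW] at hWt ht hWa
  linarith
end
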